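/- arXiv:1402.3950 — 11 statements merged into one kernel-verified Lean document; each statement's English description precedes it below -/
import Mathlib

section
/- Let λ ∈ ℝ, let s > 1 be real, and let k ≥ 1 be an integer. On the open set of z ∈ ℝ with λ·e^z > −1, the function I_k^s is differentiable and its derivative satisfies (I_k^s)'(z) = I_k^{s−1}(z). -/
open MeasureTheory Filter Set

/-- The Fermi-type integral `I_k^s(z) = (1/Γ(s)) ∫₀^∞ t^{s-1} / (e^{t-z} + λ)^k dt`. -/
noncomputable def fermiI (lam s : ℝ) (k : ℕ) (z : ℝ) : ℝ :=
  (1 / Real.Gamma s) * ∫ t in Set.Ioi (0 : ℝ), t ^ (s - 1) / (Real.exp (t - z) + lam) ^ k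

open Topology

/-- Locally uniformly in `z`, the denominator `e^{t-z} + λ` is comparable to `e^t` from below. -/
lemma eventually_mul_exp_le_exp_sub_add {lam z : ℝ} (hz : lam * Real.exp z > -1) :
    ∃ m > 0, ∀ᶠ w in 𝓝 z, ∀ t : ℝ, 0 ≤ t → m * Real.exp t ≤ Real.exp (t - w) + lam := by
  have hpos : 0 < Real.exp (-z) + lam := by
    have h : Real.exp (-z) + lam = Real.exp (-z) * (1 + lam * Real.exp z) := by
      have : Real.exp (-z) * Real.exp z = 1 := by rw [← Real.exp_add]; simp
      linear_combination -lam * this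
    rw [h]
    exact mul_pos (Real.exp_pos _) (by linarith)
  obtain ⟨m, hm, hm'⟩ := exists_between (lt_min (Real.exp_pos (-z)) hpos)
  obtain ⟨hm₁, hm₂⟩ := lt_min_iff.1 hm'
  have hcont : Continuous fun w : ℝ ↦ Real.exp (-w) := by fun_prop
  have hcont' : Continuous fun w : ℝ ↦ Real.exp (-w) + lam := by fun_prop
  refine ⟨m, hm, ?_⟩
  filter_upwards [hcont.continuousAt.eventually_const_lt hm₁,
    hcont'.continuousAt.eventually_const_lt hm₂] with w hw₁ hw₂ t ht
  rw [sub_eq_add_neg, Real.exp_add]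
  nlinarith [mul_nonneg (sub_nonneg.2 hw₁.le) (sub_nonneg.2 (Real.one_le_exp ht))]

lemma exp_sub_add_pos {lam m t w : ℝ} (hm : 0 < m)
    (hD : m * Real.exp t ≤ Real.exp (t - w) + lam) : 0 < Real.exp (t - w) + lam :=
  (mul_pos hm (Real.exp_pos t)).trans_le hD

lemma inv_pow_le_mul_exp_neg {m t D : ℝ} {k : ℕ} (hm : 0 < m) (hk : 1 ≤ k) (ht : 0 ≤ t)
    (hD : m * Real.exp t ≤ D) : (D ^ k)⁻¹ ≤ (m ^ k)⁻¹ * Real.exp (-t) := by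
  rw [Real.exp_neg, ← mul_inv]
  refine inv_anti₀ (by positivity) ?_
  calc m ^ k * Real.exp t ≤ m ^ k * Real.exp t ^ k := by
        gcongr
        exact le_self_pow₀ (Real.one_le_exp ht) (by omega)
    _ = (m * Real.exp t) ^ k := (mul_pow _ _ _).symm
    _ ≤ D ^ k := by gcongr

lemma integrableOn_fermi_integrand {lam m s z : ℝ} {k : ℕ} (hs : 0 < s) (hk : 1 ≤ k) (hm : 0 < m)
    (hD : ∀ t : ℝ, 0 ≤ t → m * Real.exp t ≤ Real.exp (t - z) + lam) :
    IntegrableOn (fun t : ℝ ↦ t ^ (s - 1) / (Real.exp (t - z) + lam) ^ k) (Ioi 0) := by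
  refine ((Real.GammaIntegral_convergent hs).const_mul (m ^ k)⁻¹).mono'
    (Measurable.aestronglyMeasurable (by fun_prop)) ?_
  filter_upwards [ae_restrict_mem measurableSet_Ioi] with t ht
  have ht₀ : 0 < t := ht
  have hpos := exp_sub_add_pos hm (hD t ht₀.le)
  rw [Real.norm_of_nonneg (by positivity), div_eq_mul_inv]
  calc t ^ (s - 1) * ((Real.exp (t - z) + lam) ^ k)⁻¹
      ≤ t ^ (s - 1) * ((m ^ k)⁻¹ * Real.exp (-t)) := by
        gcongr
        exact inv_pow_le_mul_exp_neg hm hk ht₀.le (hD t ht₀.le)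
    _ = (m ^ k)⁻¹ * (Real.exp (-t) * t ^ (s - 1)) := by ring

lemma hasDerivAt_inv_pow {f : ℝ → ℝ} {f' x : ℝ} (k : ℕ) (hf : HasDerivAt f f' x) (h : f x ≠ 0) :
    HasDerivAt (fun y ↦ (f y ^ k)⁻¹) (-(k * f' / f x ^ (k + 1))) x := by
  refine ((hf.pow k).inv (pow_ne_zero k h)).congr_deriv ?_
  rcases k with _ | k
  · simp
  · simp only [Pi.pow_apply, Nat.add_sub_cancel]
    field_simp
    ring

/-- Integration by parts for the `z`-derivative of the Fermi integrand. -/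
lemma integral_deriv_fermi_integrand {lam m s z : ℝ} {k : ℕ} (hs : 1 < s) (hk : 1 ≤ k)
    (hm : 0 < m) (hD : ∀ t : ℝ, 0 ≤ t → m * Real.exp t ≤ Real.exp (t - z) + lam)
    (hint : IntegrableOn (fun t : ℝ ↦
      t ^ (s - 1) * (k * Real.exp (t - z) / (Real.exp (t - z) + lam) ^ (k + 1))) (Ioi 0)) :
    ∫ t in Ioi (0 : ℝ), t ^ (s - 1) * (k * Real.exp (t - z) / (Real.exp (t - z) + lam) ^ (k + 1))
      = (s - 1) * ∫ t in Ioi (0 : ℝ), t ^ (s - 1 - 1) / (Real.exp (t - z) + lam) ^ k := by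
  have hint' := (integrableOn_fermi_integrand (sub_pos.2 hs) hk hm hD).const_mul (s - 1)
  have hdenom (t : ℝ) (ht : 0 ≤ t) := hasDerivAt_inv_pow k
    (((hasDerivAt_id t).sub_const z).exp.add_const lam) (exp_sub_add_pos hm (hD t ht)).ne'
  have hcont : ContinuousWithinAt
      (fun t : ℝ ↦ t ^ (s - 1) * ((Real.exp (t - z) + lam) ^ k)⁻¹) (Ici 0) 0 :=
    ((Real.continuousAt_rpow_const 0 (s - 1) (Or.inr (by linarith))).mul
      (hdenom 0 le_rfl).continuousAt).continuousWithinAt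
  have hderiv (t : ℝ) (ht : t ∈ Ioi 0) : HasDerivAt
      (fun t : ℝ ↦ t ^ (s - 1) * ((Real.exp (t - z) + lam) ^ k)⁻¹)
      ((s - 1) * (t ^ (s - 1 - 1) / (Real.exp (t - z) + lam) ^ k) -
        t ^ (s - 1) * (k * Real.exp (t - z) / (Real.exp (t - z) + lam) ^ (k + 1))) t := by
    have ht₀ : 0 < t := ht
    refine ((Real.hasDerivAt_rpow_const (Or.inl ht₀.ne')).mul (hdenom t ht₀.le)).congr_deriv ?_
    simp only [id, mul_one]
    ring
  have hlim : Tendsto (fun t : ℝ ↦ t ^ (s - 1) * ((Real.exp (t - z) + lam) ^ k)⁻¹)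
      atTop (𝓝 0) := by
    have h := (tendsto_rpow_mul_exp_neg_mul_atTop_nhds_zero (s - 1) 1 one_pos).const_mul (m ^ k)⁻¹
    rw [mul_zero] at h
    refine tendsto_of_tendsto_of_tendsto_of_le_of_le' tendsto_const_nhds h ?_ ?_
    · filter_upwards [eventually_ge_atTop 0] with t ht
      have := exp_sub_add_pos hm (hD t ht)
      positivity
    · filter_upwards [eventually_ge_atTop 0] with t ht
      calc t ^ (s - 1) * ((Real.exp (t - z) + lam) ^ k)⁻¹
          ≤ t ^ (s - 1) * ((m ^ k)⁻¹ * Real.exp (-t)) := by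
            gcongr
            exact inv_pow_le_mul_exp_neg hm hk ht (hD t ht)
        _ = (m ^ k)⁻¹ * (t ^ (s - 1) * Real.exp (-1 * t)) := by rw [neg_one_mul]; ring
  have h := integral_Ioi_of_hasDerivAt_of_tendsto hcont hderiv (hint'.sub hint) hlim
  rw [integral_sub hint' hint, integral_const_mul, Real.zero_rpow (by linarith)] at h
  linarith

/-- For `s > 1` and `k ≥ 1`, on the open set `{z | λ·e^z > -1}` the function `I_k^s`
is differentiable with derivative `I_k^{s-1}`. -/
theorem fermiI_hasDerivAt (lam s : ℝ) (hs : 1 < s) (k : ℕ) (hk : 1 ≤ k) :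
    ∀ z : ℝ, lam * Real.exp z > -1 →
      HasDerivAt (fermiI lam s k) (fermiI lam (s - 1) k z) z := by
  intro z hz
  obtain ⟨m, hm, hev⟩ := eventually_mul_exp_le_exp_sub_add hz
  have hexp : ∀ᶠ w in 𝓝 z, Real.exp (-w) < Real.exp (-z) + 1 :=
    (by fun_prop : Continuous fun w : ℝ ↦ Real.exp (-w)).continuousAt.eventually_lt_const
      (lt_add_one _)
  have hD := hev.self_of_nhds
  set C : ℝ := k * ((Real.exp (-z) + 1) * (m ^ (k + 1))⁻¹)
  obtain ⟨hint, hderiv⟩ := hasDerivAt_integral_of_dominated_loc_of_deriv_le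
    (μ := volume.restrict (Ioi (0 : ℝ)))
    (F := fun w t ↦ t ^ (s - 1) / (Real.exp (t - w) + lam) ^ k)
    (F' := fun w t ↦
      t ^ (s - 1) * (k * Real.exp (t - w) / (Real.exp (t - w) + lam) ^ (k + 1)))
    (bound := fun t ↦ C * (Real.exp (-t) * t ^ (s - 1))) (hev.and hexp)
    (Eventually.of_forall fun w ↦ Measurable.aestronglyMeasurable (by fun_prop))
    (integrableOn_fermi_integrand (by linarith) hk hm hD)
    (Measurable.aestronglyMeasurable (by fun_prop))
    (by
      filter_upwards [ae_restrict_mem measurableSet_Ioi] with t ht w ⟨hw, hw'⟩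
      have ht₀ : 0 < t := ht
      have hpos := exp_sub_add_pos hm (hw t ht₀.le)
      rw [Real.norm_of_nonneg (by positivity)]
      have hle : ((Real.exp (t - w) + lam) ^ (k + 1))⁻¹ ≤
          (m ^ (k + 1))⁻¹ * (Real.exp (-t) * Real.exp (-t)) := by
        have h₁ : ((Real.exp (t - w) + lam) ^ k)⁻¹ ≤ (m ^ k)⁻¹ * Real.exp (-t) :=
          inv_pow_le_mul_exp_neg hm hk ht₀.le (hw t ht₀.le)
        have h₂ : ((Real.exp (t - w) + lam) ^ 1)⁻¹ ≤ (m ^ 1)⁻¹ * Real.exp (-t) :=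
          inv_pow_le_mul_exp_neg hm le_rfl ht₀.le (hw t ht₀.le)
        calc ((Real.exp (t - w) + lam) ^ (k + 1))⁻¹
            = ((Real.exp (t - w) + lam) ^ k)⁻¹ * ((Real.exp (t - w) + lam) ^ 1)⁻¹ := by
              rw [pow_add, mul_inv]
          _ ≤ ((m ^ k)⁻¹ * Real.exp (-t)) * ((m ^ 1)⁻¹ * Real.exp (-t)) := by gcongr
          _ = (m ^ (k + 1))⁻¹ * (Real.exp (-t) * Real.exp (-t)) := by
              rw [pow_add, mul_inv]; ring
      calc t ^ (s - 1) * (k * Real.exp (t - w) / (Real.exp (t - w) + lam) ^ (k + 1))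
          = t ^ (s - 1) * (k * (Real.exp t * Real.exp (-w)) *
              ((Real.exp (t - w) + lam) ^ (k + 1))⁻¹) := by
            rw [← Real.exp_add, ← sub_eq_add_neg, div_eq_mul_inv]
        _ ≤ t ^ (s - 1) * (k * (Real.exp t * (Real.exp (-z) + 1)) *
              ((m ^ (k + 1))⁻¹ * (Real.exp (-t) * Real.exp (-t)))) := by gcongr
        _ = C * (Real.exp (-t) * t ^ (s - 1)) := by
            have h : Real.exp t * Real.exp (-t) = 1 := by rw [← Real.exp_add]; simp
            linear_combination (C * Real.exp (-t) * t ^ (s - 1)) * h)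
    ((Real.GammaIntegral_convergent (by linarith)).const_mul C)
    (by
      filter_upwards [ae_restrict_mem measurableSet_Ioi] with t ht w ⟨hw, _⟩
      have ht₀ : 0 ≤ t := (mem_Ioi.1 ht).le
      refine ((hasDerivAt_inv_pow k (((hasDerivAt_id w).const_sub t).exp.add_const lam)
        (exp_sub_add_pos hm (hw t ht₀)).ne').const_mul (t ^ (s - 1))).congr_deriv ?_
      simp only [id]
      ring)
  rw [integral_deriv_fermi_integrand hs hk hm hD hint] at hderiv
  refine (hderiv.const_mul (1 / Real.Gamma s)).congr_deriv ?_
  have hΓ : Real.Gamma s = (s - 1) * Real.Gamma (s - 1) := by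
    simpa using Real.Gamma_add_one (sub_pos.2 hs).ne'
  have hs₁ : s - 1 ≠ 0 := (sub_pos.2 hs).ne'
  have hΓ₁ : Real.Gamma (s - 1) ≠ 0 := (Real.Gamma_pos_of_pos (sub_pos.2 hs)).ne'
  rw [fermiI, hΓ]
  field_simp
end

section
/- Let λ ∈ ℝ, let s > 0 be real, and let k ≥ 1 be an integer. On the open set of z ∈ ℝ with λ·e^z > −1, the function I_k^s is differentiable and (I_k^s)'(z) = k·(I_k^s(z) − λ·I_{k+1}^s(z)). In particular, if λ ≠ 0 then I_{k+1}^s(z) = (1/λ)·(I_k^s(z) − (1/k)·(I_k^s)'(z)). -/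
open MeasureTheory Filter Set

/-- The integrand of `fermiI`. -/
noncomputable def fermiIntegrand (lam s : ℝ) (k : ℕ) (z t : ℝ) : ℝ :=
  t ^ (s - 1) / (Real.exp (t - z) + lam) ^ k

/-- A lower bound for `e^{t-x} + λ`, uniform in `t ≥ 0` and `x ≤ w`. -/
theorem mul_exp_le_exp_sub_add {lam w x t : ℝ} (hx : x ≤ w) (ht : 0 ≤ t) :
    (Real.exp (-w) + min lam 0) * Real.exp t ≤ Real.exp (t - x) + lam := by
  have h1 : Real.exp (-w) * Real.exp t ≤ Real.exp (t - x) := by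
    rw [← Real.exp_add]
    exact Real.exp_le_exp.mpr (by linarith)
  have h2 : min lam 0 * Real.exp t ≤ lam :=
    (mul_le_of_one_le_right (min_le_right _ _) (Real.one_le_exp ht)).trans (min_le_left _ _)
  linarith [add_mul (Real.exp (-w)) (min lam 0) (Real.exp t)]

theorem exp_neg_add_min_pos {lam w : ℝ} (hw : -1 < lam * Real.exp w) :
    0 < Real.exp (-w) + min lam 0 := by
  rcases le_total lam 0 with h | h
  · rw [min_eq_left h, Real.exp_neg]
    have hp := Real.exp_pos w
    have : (Real.exp w)⁻¹ + lam = (1 + lam * Real.exp w) / Real.exp w := by field_simp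
    rw [this]
    exact div_pos (by linarith) hp
  · rw [min_eq_right h, add_zero]
    exact Real.exp_pos _

theorem measurable_fermiIntegrand (lam s : ℝ) (k : ℕ) (z : ℝ) :
    Measurable (fermiIntegrand lam s k z) := by
  unfold fermiIntegrand
  fun_prop

theorem norm_fermiIntegrand_le {lam w x t c : ℝ} (s : ℝ) {k : ℕ} (hk : 1 ≤ k)
    (hc : c = Real.exp (-w) + min lam 0) (hpos : 0 < c) (hx : x ≤ w) (ht : 0 ≤ t) :
    ‖fermiIntegrand lam s k x t‖ ≤ (c ^ k)⁻¹ * (Real.exp (-t) * t ^ (s - 1)) := by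
  have hlow : c * Real.exp t ≤ Real.exp (t - x) + lam := hc ▸ mul_exp_le_exp_sub_add hx ht
  have hce : 0 < c * Real.exp t := mul_pos hpos (Real.exp_pos t)
  have hr : 0 ≤ t ^ (s - 1) := Real.rpow_nonneg ht _
  have hpow : c ^ k * Real.exp t ≤ (Real.exp (t - x) + lam) ^ k :=
    calc c ^ k * Real.exp t ≤ c ^ k * Real.exp t ^ k := by
          gcongr
          exact le_self_pow₀ (Real.one_le_exp ht) (by omega)
      _ = (c * Real.exp t) ^ k := (mul_pow _ _ _).symm
      _ ≤ _ := by gcongr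
  have hden : 0 < (Real.exp (t - x) + lam) ^ k := pow_pos (hce.trans_le hlow) k
  rw [fermiIntegrand, Real.norm_of_nonneg (div_nonneg hr hden.le)]
  calc t ^ (s - 1) / (Real.exp (t - x) + lam) ^ k ≤ t ^ (s - 1) / (c ^ k * Real.exp t) := by
        gcongr
    _ = (c ^ k)⁻¹ * (Real.exp (-t) * t ^ (s - 1)) := by
        rw [Real.exp_neg]
        field_simp

theorem integrableOn_fermiIntegrand {lam s z : ℝ} (hs : 0 < s) {k : ℕ} (hk : 1 ≤ k)
    (hz : -1 < lam * Real.exp z) : IntegrableOn (fermiIntegrand lam s k z) (Ioi 0) := by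
  refine ((Real.GammaIntegral_convergent hs).const_mul
    (((Real.exp (-z) + min lam 0) ^ k)⁻¹)).mono'
    (measurable_fermiIntegrand lam s k z).aestronglyMeasurable ?_
  filter_upwards [ae_restrict_mem measurableSet_Ioi] with t ht
  exact norm_fermiIntegrand_le s hk rfl (exp_neg_add_min_pos hz) le_rfl (le_of_lt ht)

theorem hasDerivAt_fermiIntegrand {lam x t : ℝ} (s : ℝ) (k : ℕ)
    (h : Real.exp (t - x) + lam ≠ 0) :
    HasDerivAt (fun y ↦ fermiIntegrand lam s k y t)
      (k * (fermiIntegrand lam s k x t - lam * fermiIntegrand lam s (k + 1) x t)) x := by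
  have hD : HasDerivAt (fun y ↦ Real.exp (t - y) + lam) (Real.exp (t - x) * -1) x :=
    (((hasDerivAt_id x).const_sub t).exp).add_const lam
  have hF := (hasDerivAt_const x (t ^ (s - 1))).fun_div (hD.fun_pow k) (pow_ne_zero k h)
  refine hF.congr_deriv ?_
  rcases k with _ | k
  · simp
  · simp only [fermiIntegrand, Nat.add_sub_cancel]
    field_simp
    ring

theorem hasDerivAt_fermiI {lam s z : ℝ} (hs : 0 < s) {k : ℕ} (hk : 1 ≤ k)
    (hz : -1 < lam * Real.exp z) :
    HasDerivAt (fermiI lam s k)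
      ((k : ℝ) * (fermiI lam s k z - lam * fermiI lam s (k + 1) z)) z := by
  obtain ⟨w, hzw, hw⟩ : ∃ w, z < w ∧ -1 < lam * Real.exp w := by
    have hcont : Continuous fun w ↦ lam * Real.exp w := by fun_prop
    have hev := hcont.continuousAt.eventually (lt_mem_nhds hz)
    obtain ⟨w, hw, hzw⟩ :=
      ((hev.filter_mono nhdsWithin_le_nhds).and (self_mem_nhdsWithin (s := Ioi z))).exists
    exact ⟨w, hzw, hw⟩
  obtain ⟨c, hc⟩ : ∃ c, c = Real.exp (-w) + min lam 0 := ⟨_, rfl⟩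
  have hpos : 0 < c := hc ▸ exp_neg_add_min_pos hw
  have hI := integrableOn_fermiIntegrand hs hk hz
  have hI' := integrableOn_fermiIntegrand hs (Nat.le_add_left 1 k) hz
  have key := (hasDerivAt_integral_of_dominated_loc_of_deriv_le (μ := volume.restrict (Ioi 0))
    (F := fermiIntegrand lam s k)
    (F' := fun x t ↦ k * (fermiIntegrand lam s k x t - lam * fermiIntegrand lam s (k + 1) x t))
    (bound := fun t ↦ (k * ((c ^ k)⁻¹ + |lam| * (c ^ (k + 1))⁻¹)) *
      (Real.exp (-t) * t ^ (s - 1)))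
    (Iio_mem_nhds hzw)
    (Eventually.of_forall fun x ↦ (measurable_fermiIntegrand lam s k x).aestronglyMeasurable)
    hI
    ((hI.sub (hI'.const_mul lam)).const_mul (k : ℝ)).aestronglyMeasurable
    (by
      filter_upwards [ae_restrict_mem measurableSet_Ioi] with t ht x hx
      have h1 := norm_fermiIntegrand_le s hk hc hpos (le_of_lt hx) (le_of_lt ht)
      have h2 := norm_fermiIntegrand_le s (Nat.le_add_left 1 k) hc hpos (le_of_lt hx) (le_of_lt ht)
      calc ‖k * (fermiIntegrand lam s k x t - lam * fermiIntegrand lam s (k + 1) x t)‖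
          ≤ k * (‖fermiIntegrand lam s k x t‖ + |lam| * ‖fermiIntegrand lam s (k + 1) x t‖) := by
            rw [norm_mul, Real.norm_natCast, ← Real.norm_eq_abs lam, ← norm_mul]
            gcongr
            exact norm_sub_le _ _
        _ ≤ k * ((c ^ k)⁻¹ * (Real.exp (-t) * t ^ (s - 1)) +
              |lam| * ((c ^ (k + 1))⁻¹ * (Real.exp (-t) * t ^ (s - 1)))) := by gcongr
        _ = _ := by ring)
    ((Real.GammaIntegral_convergent hs).const_mul _)
    (by
      filter_upwards [ae_restrict_mem measurableSet_Ioi] with t ht x hx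
      refine hasDerivAt_fermiIntegrand s k (ne_of_gt ?_)
      exact (mul_pos hpos (Real.exp_pos t)).trans_le
        (hc ▸ mul_exp_le_exp_sub_add (le_of_lt hx) (le_of_lt ht)))).2
  refine (key.const_mul (1 / Real.Gamma s)).congr_deriv ?_
  rw [integral_const_mul, integral_sub hI (hI'.const_mul lam), integral_const_mul]
  simp only [fermiI, fermiIntegrand]
  ring

/-- For `s > 0` and `k ≥ 1`, on the open set `{z | λ·e^z > -1}` the function `I_k^s`
is differentiable with `(I_k^s)'(z) = k (I_k^s(z) - λ I_{k+1}^s(z))`; in particular,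
if `λ ≠ 0`, `I_{k+1}^s(z) = (1/λ)(I_k^s(z) - (1/k)(I_k^s)'(z))`. -/
theorem fermiI_deriv_recursion (lam s : ℝ) (hs : 0 < s) (k : ℕ) (hk : 1 ≤ k) :
    ∀ z : ℝ, lam * Real.exp z > -1 →
      HasDerivAt (fermiI lam s k)
        ((k : ℝ) * (fermiI lam s k z - lam * fermiI lam s (k + 1) z)) z ∧
      (lam ≠ 0 → fermiI lam s (k + 1) z
        = (1 / lam) * (fermiI lam s k z - (1 / (k : ℝ)) * deriv (fermiI lam s k) z)) := by
  intro z hz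
  have h := hasDerivAt_fermiI hs hk hz
  refine ⟨h, fun hlam ↦ ?_⟩
  have hk0 : (k : ℝ) ≠ 0 := Nat.cast_ne_zero.mpr (by omega)
  rw [h.deriv]
  field_simp
  ring
end

section
/- Let d ≥ 1 be an integer, T > 0, λ ∈ ℝ, A ∈ ℝ with λ·e^{A/T} > −1, and B ∈ ℝ^d. Then ∫_{ℝ^d} (e^{(|p−B|²/2 − A)/T} + λ)^{−1} dp = n_d · φ_{d/2}(A/T), and for each 1 ≤ i ≤ d, ∫_{ℝ^d} p_i · (e^{(|p−B|²/2 − A)/T} + λ)^{−1} dp = B_i · n_d · φ_{d/2}(A/T). -/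
open MeasureTheory Filter Set

/-- Radial integration over `ℝ^d` in the variable `t = |p|² / (2T)`. -/
theorem integral_comp_norm_sq_div (d : ℕ) (hd : 1 ≤ d) {T : ℝ} (hT : 0 < T) (G : ℝ → ℝ) :
    ∫ p : EuclideanSpace ℝ (Fin d), G (‖p‖ ^ 2 / (2 * T)) =
      (2 * Real.pi * T) ^ ((d : ℝ) / 2) * ((1 / Real.Gamma ((d : ℝ) / 2)) *
        ∫ t in Ioi (0 : ℝ), t ^ ((d : ℝ) / 2 - 1) * G t) := by
  have : Nonempty (Fin d) := ⟨⟨0, hd⟩⟩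
  have hd' : (0 : ℝ) < d := by exact_mod_cast hd
  have hT2 : (0 : ℝ) < 2 * T := by positivity
  have hpi := Real.pi_pos
  have hΓ : 0 < Real.Gamma ((d : ℝ) / 2) := Real.Gamma_pos_of_pos (by positivity)
  have hball : volume.real (Metric.ball (0 : EuclideanSpace ℝ (Fin d)) 1) =
      Real.pi ^ ((d : ℝ) / 2) / ((d : ℝ) / 2 * Real.Gamma ((d : ℝ) / 2)) := by
    rw [Measure.real, EuclideanSpace.volume_ball, Fintype.card_fin,
      Real.Gamma_add_one (by positivity), Real.sqrt_eq_rpow, ← Real.rpow_mul_natCast hpi.le,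
      ENNReal.ofReal_one, one_pow, one_mul, ENNReal.toReal_ofReal (by positivity)]
    congr 2
    ring
  have hsub : ∫ t in Ioi (0 : ℝ), t ^ ((d : ℝ) / 2 - 1) * G t =
      2 * (2 * T) ^ (-((d : ℝ) / 2)) *
        ∫ y in Ioi (0 : ℝ), y ^ (d - 1) * G (y ^ 2 / (2 * T)) := by
    have hscale := integral_comp_mul_left_Ioi
      (fun t : ℝ => t ^ ((d : ℝ) / 2 - 1) * G t) 0 (inv_pos.2 hT2)
    rw [mul_zero, inv_inv, smul_eq_mul] at hscale
    have hinv : ∫ t in Ioi (0 : ℝ), t ^ ((d : ℝ) / 2 - 1) * G t = (2 * T)⁻¹ *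
        ∫ x in Ioi (0 : ℝ), ((2 * T)⁻¹ * x) ^ ((d : ℝ) / 2 - 1) * G ((2 * T)⁻¹ * x) := by
      rw [hscale, inv_mul_cancel_left₀ hT2.ne']
    rw [hinv, ← integral_comp_rpow_Ioi_of_pos (p := 2) two_pos, ← integral_const_mul,
      ← integral_const_mul]
    refine setIntegral_congr_fun measurableSet_Ioi fun y hy => ?_
    have hy : 0 < y := hy
    have h1 : ((2 * T)⁻¹ * y ^ (2 : ℝ)) ^ ((d : ℝ) / 2 - 1) =
        (2 * T) * (2 * T) ^ (-((d : ℝ) / 2)) * (y ^ (d - 1) / y) := by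
      rw [Real.mul_rpow (by positivity) (by positivity), ← Real.rpow_mul hy.le,
        Real.inv_rpow hT2.le, ← Real.rpow_neg hT2.le,
        show -((d : ℝ) / 2 - 1) = 1 + -((d : ℝ) / 2) by ring, Real.rpow_add hT2, Real.rpow_one,
        show (2 : ℝ) * ((d : ℝ) / 2 - 1) = ((d - 1 : ℕ) : ℝ) - 1 by
          rw [Nat.cast_sub hd]; push_cast; ring,
        Real.rpow_sub_one hy.ne', Real.rpow_natCast]
    have h2 : (2 * T)⁻¹ * y ^ (2 : ℝ) = y ^ 2 / (2 * T) := by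
      rw [Real.rpow_two]; ring
    have h3 : y ^ ((2 : ℝ) - 1) = y := by norm_num
    simp only [smul_eq_mul]
    rw [h1, h2, h3]
    field_simp
  have hpow : (2 * Real.pi * T) ^ ((d : ℝ) / 2) * (2 * T) ^ (-((d : ℝ) / 2)) =
      Real.pi ^ ((d : ℝ) / 2) := by
    rw [show 2 * Real.pi * T = Real.pi * (2 * T) by ring, Real.mul_rpow hpi.le hT2.le, mul_assoc,
      ← Real.rpow_add hT2, add_neg_cancel, Real.rpow_zero, mul_one]
  rw [integral_fun_norm_addHaar volume (fun y : ℝ => G (y ^ 2 / (2 * T))), hball, hsub,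
    finrank_euclideanSpace_fin, ← hpow]
  simp only [smul_eq_mul, nsmul_eq_mul]
  field_simp

theorem integrable_norm_pow_mul_exp_neg_mul_sq (d : ℕ) (hd : 1 ≤ d) (j : ℕ) {b : ℝ} (hb : 0 < b) :
    Integrable fun p : EuclideanSpace ℝ (Fin d) => ‖p‖ ^ j * Real.exp (-b * ‖p‖ ^ 2) := by
  have : Nonempty (Fin d) := ⟨⟨0, hd⟩⟩
  rw [integrable_fun_norm_addHaar volume (f := fun y : ℝ => y ^ j * Real.exp (-b * y ^ 2))]
  have hs : (-1 : ℝ) < ((Module.finrank ℝ (EuclideanSpace ℝ (Fin d)) - 1 + j : ℕ) : ℝ) :=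
    neg_one_lt_zero.trans_le (Nat.cast_nonneg _)
  refine (integrableOn_rpow_mul_exp_neg_mul_sq hb hs).congr_fun (fun y _ => ?_) measurableSet_Ioi
  simp only [smul_eq_mul]
  rw [Real.rpow_natCast, pow_add, mul_assoc]

/-- The Fermi-type weight is dominated by a Maxwellian. -/
theorem exists_inv_exp_sub_add_le {lam z : ℝ} (hz : -1 < lam * Real.exp z) :
    ∃ C : ℝ, ∀ t : ℝ, 0 ≤ t → |(Real.exp (t - z) + lam)⁻¹| ≤ C * Real.exp (-t) := by
  set c := min 1 (1 + lam * Real.exp z)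
  have hc0 : 0 < c := lt_min one_pos (by linarith)
  refine ⟨Real.exp z / c, fun t ht => ?_⟩
  have hkey : c * Real.exp (t - z) ≤ Real.exp (t - z) + lam := by
    have h1 : c ≤ 1 := min_le_left _ _
    have h2 : c ≤ 1 + lam * Real.exp z := min_le_right _ _
    have he : Real.exp (-z) ≤ Real.exp (t - z) := Real.exp_le_exp.2 (by linarith)
    have hzz : Real.exp z * Real.exp (-z) = 1 := by rw [← Real.exp_add]; simp
    have h3 : (c - 1) * Real.exp (t - z) ≤ (c - 1) * Real.exp (-z) :=
      mul_le_mul_of_nonpos_left he (by linarith)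
    have h4 : (c - 1) * Real.exp (-z) ≤ lam * Real.exp z * Real.exp (-z) :=
      mul_le_mul_of_nonneg_right (by linarith) (Real.exp_pos _).le
    rw [mul_assoc, hzz] at h4
    linarith
  have hpos : 0 < c * Real.exp (t - z) := by positivity
  rw [abs_of_pos (inv_pos.2 (hpos.trans_le hkey))]
  refine (inv_anti₀ hpos hkey).trans_eq ?_
  rw [mul_inv, ← Real.exp_neg, neg_sub, sub_eq_add_neg, Real.exp_add]
  ring

theorem integrable_norm_pow_mul_inv_exp_add (d : ℕ) (hd : 1 ≤ d) (j : ℕ) {T lam z : ℝ}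
    (hT : 0 < T) (hz : -1 < lam * Real.exp z) :
    Integrable fun p : EuclideanSpace ℝ (Fin d) =>
      ‖p‖ ^ j * (Real.exp (‖p‖ ^ 2 / (2 * T) - z) + lam)⁻¹ := by
  obtain ⟨C, hC⟩ := exists_inv_exp_sub_add_le hz
  have hb : 0 < (2 * T)⁻¹ := by positivity
  refine ((integrable_norm_pow_mul_exp_neg_mul_sq d hd j hb).const_mul C).mono'
    (by apply Measurable.aestronglyMeasurable; fun_prop) (.of_forall fun p => ?_)
  rw [norm_mul, norm_pow, norm_norm, Real.norm_eq_abs]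
  calc _ ≤ ‖p‖ ^ j * (C * Real.exp (-(‖p‖ ^ 2 / (2 * T)))) :=
        mul_le_mul_of_nonneg_left (hC _ (by positivity)) (by positivity)
    _ = _ := by
        rw [show -(‖p‖ ^ 2 / (2 * T)) = -(2 * T)⁻¹ * ‖p‖ ^ 2 by ring]
        ring

theorem integral_coord_mul_radial_eq_zero {d : ℕ} (i : Fin d) (G : ℝ → ℝ) :
    ∫ p : EuclideanSpace ℝ (Fin d), p i * G ‖p‖ = 0 := by
  have h := integral_neg_eq_self (fun p : EuclideanSpace ℝ (Fin d) => p i * G ‖p‖) volume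
  simp only [norm_neg, PiLp.neg_apply, neg_mul, integral_neg] at h
  linarith

/-- `∫_{ℝ^d} (e^{(|p-B|²/2 - A)/T} + λ)⁻¹ dp = n_d φ_{d/2}(A/T)` and
`∫_{ℝ^d} p_i (e^{(|p-B|²/2 - A)/T} + λ)⁻¹ dp = B_i n_d φ_{d/2}(A/T)`,
with `n_d = (2πT)^{d/2}`. -/
theorem equilibrium_moments (d : ℕ) (hd : 1 ≤ d) (T : ℝ) (hT : 0 < T)
    (lam A : ℝ) (hz : lam * Real.exp (A / T) > -1) (B : EuclideanSpace ℝ (Fin d)) :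
    (∫ p : EuclideanSpace ℝ (Fin d),
        (Real.exp ((‖p - B‖ ^ 2 / 2 - A) / T) + lam)⁻¹)
      = (2 * Real.pi * T) ^ ((d : ℝ) / 2) * fermiI lam ((d : ℝ) / 2) 1 (A / T) ∧
    ∀ i : Fin d,
      (∫ p : EuclideanSpace ℝ (Fin d),
          p i * (Real.exp ((‖p - B‖ ^ 2 / 2 - A) / T) + lam)⁻¹)
        = B i * ((2 * Real.pi * T) ^ ((d : ℝ) / 2) * fermiI lam ((d : ℝ) / 2) 1 (A / T)) := by
  set W : EuclideanSpace ℝ (Fin d) → ℝ :=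
    fun p => (Real.exp (‖p‖ ^ 2 / (2 * T) - A / T) + lam)⁻¹ with hW
  have hshift : ∀ p : EuclideanSpace ℝ (Fin d),
      (Real.exp ((‖p - B‖ ^ 2 / 2 - A) / T) + lam)⁻¹ = W (p - B) := fun p => by
    rw [sub_div, div_div]
  have hmass : ∫ p, W p =
      (2 * Real.pi * T) ^ ((d : ℝ) / 2) * fermiI lam ((d : ℝ) / 2) 1 (A / T) := by
    rw [fermiI, hW,
      integral_comp_norm_sq_div d hd hT fun t => (Real.exp (t - A / T) + lam)⁻¹]
    simp only [pow_one, div_eq_mul_inv]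
  have hint : Integrable W := by
    simpa using integrable_norm_pow_mul_inv_exp_add d hd 0 hT hz
  refine ⟨?_, fun i => ?_⟩
  · simp only [hshift]
    rw [integral_sub_right_eq_self W B, hmass]
  · have hcoord : Integrable fun p : EuclideanSpace ℝ (Fin d) => p i * W p := by
      refine (integrable_norm_pow_mul_inv_exp_add d hd 1 hT hz).mono
        (by apply Measurable.aestronglyMeasurable; fun_prop) (.of_forall fun p => ?_)
      rw [norm_mul, norm_mul, pow_one, norm_norm]
      exact mul_le_mul_of_nonneg_right (PiLp.norm_apply_le p i) (norm_nonneg _)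
    calc _ = ∫ p : EuclideanSpace ℝ (Fin d), (p - B + B) i * W (p - B) := by
          simp only [hshift, sub_add_cancel]
      _ = ∫ p : EuclideanSpace ℝ (Fin d), (p + B) i * W p :=
          integral_sub_right_eq_self (fun p : EuclideanSpace ℝ (Fin d) => (p + B) i * W p) B
      _ = ∫ p : EuclideanSpace ℝ (Fin d), (p i * W p + B i * W p) := by
          simp only [PiLp.add_apply, add_mul]
      _ = _ := by
          rw [integral_add hcoord (hint.const_mul _), integral_const_mul, hmass,
            integral_coord_mul_radial_eq_zero i
              fun r => (Real.exp (r ^ 2 / (2 * T) - A / T) + lam)⁻¹, zero_add]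
end

section
/- Let d ≥ 1 be an integer, T > 0 and λ ∈ ℝ. Let D := ℝ if λ ≥ 0 and D := (−∞, −T·log|λ|) if λ < 0, and define N(A) := ∫_{ℝ^d} (e^{(|p|²/2 − A)/T} + λ)^{−1} dp for A ∈ D. Then N is strictly increasing on D with infimum 0, and its supremum equals n_d · ζ(d/2)/|λ| if λ < 0 and d ≥ 3, and equals +∞ otherwise (ζ denoting the Riemann zeta function). Consequently, for every n with 0 < n < n_d·ζ(d/2)/|λ| (in the case λ < 0 and d ≥ 3) or 0 < n < ∞ (otherwise), there exists a unique A ∈ D with N(A) = n. -/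
open MeasureTheory Filter Set

/-- The distance of the inverse fugacity `e^{-A/T}` from the pole of the occupation number at zero
energy; it is positive exactly for admissible chemical potentials. -/
noncomputable def fugacityGap (T lam A : ℝ) : ℝ := Real.exp (-A / T) + min lam 0

/-- The mean occupation number at energy `x` and chemical potential `A`. -/
noncomputable def occupation (T lam A x : ℝ) : ℝ := (Real.exp ((x - A) / T) + lam)⁻¹

section Pointwise

variable {T lam : ℝ}

lemma fugacityGap_pos_iff (hT : 0 < T) (A : ℝ) :
    0 < fugacityGap T lam A ↔
      A ∈ (if 0 ≤ lam then Set.univ else Set.Iio (-T * Real.log |lam|)) := by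
  unfold fugacityGap
  split_ifs with h
  · simp only [min_eq_right h, add_zero, mem_univ, iff_true]
    positivity
  · push Not at h
    rw [min_eq_left h.le, abs_of_neg h, mem_Iio, ← neg_lt_iff_pos_add,
      ← Real.log_lt_iff_lt_exp (by linarith), lt_div_iff₀ hT]
    constructor <;> intro h' <;> linarith

lemma fugacityGap_strictAnti (hT : 0 < T) : StrictAnti (fugacityGap T lam) := fun A B h => by
  unfold fugacityGap
  gcongr

lemma fugacityGap_mul_exp_le (hT : 0 < T) (A : ℝ) {x : ℝ} (hx : 0 ≤ x) :
    fugacityGap T lam A * Real.exp (x / T) ≤ Real.exp ((x - A) / T) + lam := by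
  have h1 : Real.exp ((x - A) / T) = Real.exp (-A / T) * Real.exp (x / T) := by
    rw [← Real.exp_add]; ring_nf
  have h2 : 1 ≤ Real.exp (x / T) := Real.one_le_exp (by positivity)
  have h3 := min_le_right lam 0
  have h4 := min_le_left lam 0
  unfold fugacityGap
  rw [h1]
  nlinarith

lemma exp_add_pos (hT : 0 < T) {A : ℝ} (hA : 0 < fugacityGap T lam A) {x : ℝ} (hx : 0 ≤ x) :
    0 < Real.exp ((x - A) / T) + lam :=
  (mul_pos hA (Real.exp_pos _)).trans_le (fugacityGap_mul_exp_le hT A hx)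

lemma occupation_pos (hT : 0 < T) {A : ℝ} (hA : 0 < fugacityGap T lam A) {x : ℝ} (hx : 0 ≤ x) :
    0 < occupation T lam A x :=
  inv_pos.2 (exp_add_pos hT hA hx)

lemma occupation_le (hT : 0 < T) {A : ℝ} (hA : 0 < fugacityGap T lam A) {x : ℝ} (hx : 0 ≤ x) :
    occupation T lam A x ≤ (fugacityGap T lam A)⁻¹ * Real.exp (-(x / T)) := by
  rw [Real.exp_neg, ← mul_inv]
  exact inv_anti₀ (mul_pos hA (Real.exp_pos _)) (fugacityGap_mul_exp_le hT A hx)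

lemma occupation_lt (hT : 0 < T) {A B : ℝ} (hB : 0 < fugacityGap T lam B) (h : A < B) {x : ℝ}
    (hx : 0 ≤ x) : occupation T lam A x < occupation T lam B x := by
  unfold occupation
  have := exp_add_pos hT hB hx
  gcongr

lemma fugacity_lt_one (hlam : lam < 0) {A : ℝ} (hA : 0 < fugacityGap T lam A) :
    |lam| * Real.exp (A / T) < 1 := by
  rw [fugacityGap, min_eq_left hlam.le, neg_div, Real.exp_neg] at hA
  have := mul_pos hA (Real.exp_pos (A / T))
  rw [add_mul, inv_mul_cancel₀ (Real.exp_pos _).ne'] at this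
  rw [abs_of_neg hlam]
  linarith

lemma hasSum_occupation (hT : 0 < T) (hlam : lam < 0) {A : ℝ} (hA : 0 < fugacityGap T lam A)
    {x : ℝ} (hx : 0 ≤ x) :
    HasSum (fun k : ℕ => |lam|⁻¹ * (|lam| * Real.exp (A / T)) ^ (k + 1) *
      Real.exp (-((k + 1 : ℝ) * (x / T)))) (occupation T lam A x) := by
  set q := |lam| * Real.exp (A / T) * Real.exp (-(x / T)) with hq
  have hpos := exp_add_pos hT hA hx
  have hl : |lam| = -lam := abs_of_neg hlam
  have hE : Real.exp ((x - A) / T) = (Real.exp (A / T) * Real.exp (-(x / T)))⁻¹ := by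
    rw [← Real.exp_add, ← Real.exp_neg]; ring_nf
  set y := Real.exp (A / T) * Real.exp (-(x / T)) with hy
  have hy0 : 0 < y := by positivity
  have hqy : q = -lam * y := by rw [hq, hl, mul_assoc]
  have hq1 : q < 1 := by
    rw [hE] at hpos
    have := mul_pos hpos hy0
    rw [add_mul, inv_mul_cancel₀ hy0.ne'] at this
    linarith
  have hs := (hasSum_geometric_of_lt_one (by positivity) hq1).mul_left (|lam|⁻¹ * q)
  have hterm : (fun k : ℕ => |lam|⁻¹ * (|lam| * Real.exp (A / T)) ^ (k + 1) *
      Real.exp (-((k + 1 : ℝ) * (x / T)))) = fun k => |lam|⁻¹ * q * q ^ k := by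
    ext k
    have h1 : Real.exp (-((k + 1 : ℝ) * (x / T))) = Real.exp (-(x / T)) ^ (k + 1) := by
      rw [← Real.exp_nat_mul]
      push_cast
      ring_nf
    rw [h1, hq]
    ring
  have hval : occupation T lam A x = |lam|⁻¹ * q * (1 - q)⁻¹ := by
    unfold occupation
    have h1 : 1 - q ≠ 0 := by linarith
    rw [hE, hl, ← div_eq_mul_inv, inv_eq_one_div, div_eq_div_iff (by rw [← hE]; exact hpos.ne') h1,
      hqy]
    have h2 := hlam.ne
    field_simp
    ring
  rwa [hterm, hval]

lemma continuous_occupation {V : Type*} [NormedAddCommGroup V] (hT : 0 < T) {A : ℝ}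
    (hA : 0 < fugacityGap T lam A) : Continuous fun p : V => occupation T lam A (‖p‖ ^ 2 / 2) := by
  unfold occupation
  exact Continuous.inv₀ (by fun_prop) fun p => (exp_add_pos hT hA (by positivity)).ne'

end Pointwise

section Integral

variable {V : Type*} [NormedAddCommGroup V] [InnerProductSpace ℝ V] [FiniteDimensional ℝ V]
  [MeasurableSpace V] [BorelSpace V] {T lam : ℝ}

lemma integral_exp_neg_mul_half_norm_sq (hT : 0 < T) {c : ℝ} (hc : 0 < c) :
    ∫ p : V, Real.exp (-(c * (‖p‖ ^ 2 / 2 / T))) =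
      (2 * Real.pi * T) ^ ((Module.finrank ℝ V : ℝ) / 2) / c ^ ((Module.finrank ℝ V : ℝ) / 2) := by
  have := GaussianFourier.integral_rexp_neg_mul_sq_norm (V := V) (b := c / (2 * T)) (by positivity)
  rw [← Real.div_rpow (by positivity) hc.le]
  have h1 : 2 * Real.pi * T / c = Real.pi / (c / (2 * T)) := by field_simp
  rw [h1, ← this]
  congr! 3
  ring

lemma integrable_exp_neg_mul_half_norm_sq (hT : 0 < T) {c : ℝ} (hc : 0 < c) :
    Integrable fun p : V => Real.exp (-(c * (‖p‖ ^ 2 / 2 / T))) :=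
  Integrable.of_integral_ne_zero (by
    rw [integral_exp_neg_mul_half_norm_sq hT hc]
    have := Real.pi_pos
    positivity)

lemma integrable_exp_neg_half_norm_sq (hT : 0 < T) :
    Integrable fun p : V => Real.exp (-(‖p‖ ^ 2 / 2 / T)) := by
  simpa using integrable_exp_neg_mul_half_norm_sq (V := V) hT one_pos

lemma integrable_occupation (hT : 0 < T) {A : ℝ} (hA : 0 < fugacityGap T lam A) :
    Integrable fun p : V => occupation T lam A (‖p‖ ^ 2 / 2) := by
  refine ((integrable_exp_neg_half_norm_sq hT).const_mul (fugacityGap T lam A)⁻¹).mono'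
    (continuous_occupation hT hA).aestronglyMeasurable (Eventually.of_forall fun p => ?_)
  have hp : 0 ≤ ‖p‖ ^ 2 / 2 := by positivity
  rw [Real.norm_of_nonneg (occupation_pos hT hA hp).le]
  exact occupation_le hT hA hp

/-- The particle density at chemical potential `A`. -/
noncomputable def density (V : Type*) [NormedAddCommGroup V] [InnerProductSpace ℝ V]
    [FiniteDimensional ℝ V] [MeasurableSpace V] [BorelSpace V] (T lam A : ℝ) : ℝ :=
  ∫ p : V, occupation T lam A (‖p‖ ^ 2 / 2)

lemma density_pos (hT : 0 < T) {A : ℝ} (hA : 0 < fugacityGap T lam A) :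
    0 < density V T lam A :=
  integral_pos_of_integrable_nonneg_nonzero (x := 0) (continuous_occupation hT hA)
    (integrable_occupation hT hA) (fun _ => (occupation_pos hT hA (by positivity)).le)
    (occupation_pos hT hA (by positivity)).ne'

lemma density_lt (hT : 0 < T) {A B : ℝ} (hB : 0 < fugacityGap T lam B) (h : A < B) :
    density V T lam A < density V T lam B := by
  have hA := hB.trans (fugacityGap_strictAnti (lam := lam) hT h)
  rw [← sub_pos, density, density,
    ← integral_sub (integrable_occupation hT hB) (integrable_occupation hT hA)]
  have hlt (p : V) := sub_pos.2 (occupation_lt hT hB h (x := ‖p‖ ^ 2 / 2) (by positivity))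
  exact integral_pos_of_integrable_nonneg_nonzero (x := 0)
    ((continuous_occupation hT hB).sub (continuous_occupation hT hA))
    ((integrable_occupation hT hB).sub (integrable_occupation hT hA))
    (fun p => (hlt p).le) (hlt 0).ne'

lemma density_le (hT : 0 < T) {A : ℝ} (hA : 0 < fugacityGap T lam A) :
    density V T lam A ≤ (fugacityGap T lam A)⁻¹ * ∫ p : V, Real.exp (-(‖p‖ ^ 2 / 2 / T)) := by
  rw [← integral_const_mul]
  exact integral_mono (integrable_occupation hT hA)
    ((integrable_exp_neg_half_norm_sq hT).const_mul _)
    fun p => occupation_le hT hA (by positivity)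

lemma tendsto_fugacityGap_atBot (hT : 0 < T) : Tendsto (fugacityGap T lam) atBot atTop := by
  refine tendsto_atTop_add_const_right _ _ (Real.tendsto_exp_atTop.comp ?_)
  exact tendsto_neg_atBot_atTop.atTop_div_const hT

lemma exists_density_lt (hT : 0 < T) {ε : ℝ} (hε : 0 < ε) :
    ∃ A, 0 < fugacityGap T lam A ∧ density V T lam A < ε := by
  have h0 : Tendsto (fun A => (fugacityGap T lam A)⁻¹ *
      ∫ p : V, Real.exp (-(‖p‖ ^ 2 / 2 / T))) atBot (nhds 0) := by
    simpa using (tendsto_inv_atTop_zero.comp (tendsto_fugacityGap_atBot hT)).mul_const _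
  obtain ⟨A, hA, hA'⟩ := (((tendsto_fugacityGap_atBot (lam := lam) hT).eventually_gt_atTop 0).and
    (h0.eventually_lt_const hε)).exists
  exact ⟨A, hA, (density_le hT hA).trans_lt hA'⟩

lemma continuous_fugacityGap (T lam : ℝ) : Continuous (fugacityGap T lam) := by
  unfold fugacityGap
  fun_prop

lemma continuousAt_density (hT : 0 < T) {A : ℝ} (hA : 0 < fugacityGap T lam A) :
    ContinuousAt (density V T lam) A := by
  have hev : ∀ᶠ B in nhds A, fugacityGap T lam A / 2 < fugacityGap T lam B :=
    (continuous_fugacityGap T lam).continuousAt.eventually_const_lt (by linarith)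
  refine continuousAt_of_dominated
    (bound := fun p => (fugacityGap T lam A / 2)⁻¹ * Real.exp (-(‖p‖ ^ 2 / 2 / T))) ?_ ?_
    ((integrable_exp_neg_half_norm_sq hT).const_mul _) (Eventually.of_forall fun p => ?_)
  · filter_upwards [hev] with B hB
    exact (continuous_occupation hT (by linarith)).aestronglyMeasurable
  · filter_upwards [hev] with B hB
    refine Eventually.of_forall fun p => ?_
    have hB0 : 0 < fugacityGap T lam B := by linarith
    have hp : 0 ≤ ‖p‖ ^ 2 / 2 := by positivity
    rw [Real.norm_of_nonneg (occupation_pos hT hB0 hp).le]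
    refine (occupation_le hT hB0 hp).trans ?_
    gcongr
  · unfold occupation
    exact ContinuousAt.inv₀ (by fun_prop) (exp_add_pos hT hA (by positivity)).ne'

lemma exists_lt_density_of_nonneg [Nontrivial V] (hT : 0 < T) (hlam : 0 ≤ lam) (M : ℝ) :
    ∃ A, 0 < fugacityGap T lam A ∧ M < density V T lam A := by
  set v := (volume : Measure V).real (Metric.ball 0 1) with hv
  have hv0 : 0 < v := ENNReal.toReal_pos (Metric.measure_ball_pos _ _ one_pos).ne'
    measure_ball_lt_top.ne
  set r := max 1 (|M| * (1 + lam) / v + 1) with hr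
  have hr1 : 1 ≤ r := le_max_left _ _
  have hgap : 0 < fugacityGap T lam (r ^ 2 / 2) := by
    rw [fugacityGap_pos_iff hT, if_pos hlam]
    trivial
  refine ⟨r ^ 2 / 2, hgap, ?_⟩
  have hball : r * v ≤ (volume : Measure V).real (Metric.ball 0 r) := by
    rw [Measure.real, Measure.addHaar_ball _ _ (by linarith), ENNReal.toReal_mul,
      ENNReal.toReal_ofReal (by positivity)]
    exact mul_le_mul_of_nonneg_right
      (le_self_pow₀ hr1 Module.finrank_pos.ne') hv0.le
  have hint := integrable_occupation (V := V) hT hgap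
  have h1 : (1 + lam)⁻¹ * (volume : Measure V).real (Metric.ball 0 r) ≤
      ∫ p in Metric.ball (0 : V) r, occupation T lam (r ^ 2 / 2) (‖p‖ ^ 2 / 2) := by
    refine setIntegral_ge_of_const_le_real measurableSet_ball measure_ball_lt_top.ne
      (fun p hp => ?_) hint.integrableOn
    rw [mem_ball_zero_iff] at hp
    have hp2 : ‖p‖ ^ 2 ≤ r ^ 2 := by gcongr
    have : Real.exp ((‖p‖ ^ 2 / 2 - r ^ 2 / 2) / T) ≤ 1 := by
      rw [Real.exp_le_one_iff]
      exact div_nonpos_of_nonpos_of_nonneg (by linarith) hT.le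
    unfold occupation
    gcongr
  have h2 := setIntegral_le_integral (s := Metric.ball (0 : V) r) hint
    (Eventually.of_forall fun p => (occupation_pos hT hgap (by positivity)).le)
  have h3 : |M| * (1 + lam) / v < r := (lt_add_one _).trans_le (le_max_right _ _)
  rw [div_lt_iff₀ hv0] at h3
  calc M ≤ |M| := le_abs_self M
    _ < (1 + lam)⁻¹ * (r * v) := by
      rw [inv_mul_eq_div, lt_div_iff₀ (by linarith)]
      exact h3
    _ ≤ (1 + lam)⁻¹ * (volume : Measure V).real (Metric.ball 0 r) := by gcongr
    _ ≤ _ := h1.trans h2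

lemma hasSum_density [Nontrivial V] (hT : 0 < T) (hlam : lam < 0) {A : ℝ}
    (hA : 0 < fugacityGap T lam A) :
    HasSum (fun k : ℕ => (2 * Real.pi * T) ^ ((Module.finrank ℝ V : ℝ) / 2) / |lam| *
      ((|lam| * Real.exp (A / T)) ^ (k + 1) / (k + 1 : ℝ) ^ ((Module.finrank ℝ V : ℝ) / 2)))
      (density V T lam A) := by
  set w := |lam| * Real.exp (A / T) with hw
  set s := (Module.finrank ℝ V : ℝ) / 2 with hs
  have hw0 : 0 < w := mul_pos (abs_pos.2 hlam.ne) (Real.exp_pos _)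
  have hw1 : w < 1 := fugacity_lt_one hlam hA
  have hpi := Real.pi_pos
  have hI (k : ℕ) : ∫ p : V, |lam|⁻¹ * w ^ (k + 1) *
      Real.exp (-((k + 1 : ℝ) * (‖p‖ ^ 2 / 2 / T))) =
      (2 * Real.pi * T) ^ s / |lam| * (w ^ (k + 1) / (k + 1 : ℝ) ^ s) := by
    rw [integral_const_mul, integral_exp_neg_mul_half_norm_sq hT (by positivity)]
    ring
  have := hasSum_integral_of_summable_integral_norm (μ := (volume : Measure V))
    (F := fun (k : ℕ) p => |lam|⁻¹ * w ^ (k + 1) *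
      Real.exp (-((k + 1 : ℝ) * (‖p‖ ^ 2 / 2 / T))))
    (fun k => (integrable_exp_neg_mul_half_norm_sq hT (by positivity)).const_mul _) ?_
  · simp only [hI] at this
    have htsum (p : V) := (hasSum_occupation hT hlam hA (x := ‖p‖ ^ 2 / 2) (by positivity)).tsum_eq
    simpa only [htsum, density, hw] using this
  · have hn (k : ℕ) (p : V) : ‖|lam|⁻¹ * w ^ (k + 1) *
        Real.exp (-((k + 1 : ℝ) * (‖p‖ ^ 2 / 2 / T)))‖ = |lam|⁻¹ * w ^ (k + 1) *
        Real.exp (-((k + 1 : ℝ) * (‖p‖ ^ 2 / 2 / T))) := Real.norm_of_nonneg (by positivity)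
    simp only [hn, hI]
    refine Summable.mul_left _ (Summable.of_nonneg_of_le (fun k => by positivity) (fun k => ?_)
      (summable_geometric_of_lt_one hw0.le hw1))
    have h1 : (1 : ℝ) ≤ (k + 1 : ℝ) ^ s :=
      Real.one_le_rpow (by linarith [k.cast_nonneg (α := ℝ)]) (by positivity)
    calc w ^ (k + 1) / (k + 1 : ℝ) ^ s ≤ w ^ (k + 1) := div_le_self (by positivity) h1
      _ ≤ w ^ k := pow_le_pow_of_le_one hw0.le hw1.le k.le_succ

lemma sum_range_le_of_density_le [Nontrivial V] (hT : 0 < T) (hlam : lam < 0) {M : ℝ}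
    (hM : ∀ A, 0 < fugacityGap T lam A → density V T lam A ≤ M) (K : ℕ) :
    ∑ k ∈ Finset.range K, (2 * Real.pi * T) ^ ((Module.finrank ℝ V : ℝ) / 2) / |lam| *
      (1 / (k + 1 : ℝ) ^ ((Module.finrank ℝ V : ℝ) / 2)) ≤ M := by
  have hpi := Real.pi_pos
  set s := (Module.finrank ℝ V : ℝ) / 2 with hs
  have hl := abs_pos.2 hlam.ne
  have hlim : Tendsto (fun w : ℝ => ∑ k ∈ Finset.range K,
      (2 * Real.pi * T) ^ s / |lam| * (w ^ (k + 1) / (k + 1 : ℝ) ^ s)) (nhdsWithin 1 (Iio 1))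
      (nhds (∑ k ∈ Finset.range K, (2 * Real.pi * T) ^ s / |lam| * (1 / (k + 1 : ℝ) ^ s))) := by
    have hc : Continuous (fun w : ℝ => ∑ k ∈ Finset.range K,
      (2 * Real.pi * T) ^ s / |lam| * (w ^ (k + 1) / (k + 1 : ℝ) ^ s)) := by fun_prop
    simpa using (hc.tendsto 1).mono_left nhdsWithin_le_nhds
  refine le_of_tendsto hlim ?_
  filter_upwards [Ioo_mem_nhdsLT (show (0 : ℝ) < 1 by norm_num)] with w hw
  have hw' : |lam| * Real.exp (T * Real.log (w / |lam|) / T) = w := by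
    rw [mul_div_cancel_left₀ _ hT.ne', Real.exp_log (div_pos hw.1 hl), mul_div_cancel₀ _ hl.ne']
  have hgap : 0 < fugacityGap T lam (T * Real.log (w / |lam|)) := by
    have : 0 < w⁻¹ - 1 := sub_pos.2 (one_lt_inv₀ hw.1 |>.2 hw.2)
    rw [fugacityGap, min_eq_left hlam.le, neg_div, mul_div_cancel_left₀ _ hT.ne', Real.exp_neg,
      Real.exp_log (div_pos hw.1 hl), inv_div]
    have h2 := mul_pos hl this
    have h3 := neg_abs_le lam
    rw [div_eq_mul_inv]
    linarith
  have h := hasSum_density (V := V) hT hlam hgap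
  rw [hw'] at h
  have hw0 := hw.1
  exact (sum_le_hasSum _ (fun k _ => by positivity) h).trans (hM _ hgap)

lemma one_lt_half_finrank_of_density_le [Nontrivial V] (hT : 0 < T) (hlam : lam < 0) {M : ℝ}
    (hM : ∀ A, 0 < fugacityGap T lam A → density V T lam A ≤ M) :
    1 < (Module.finrank ℝ V : ℝ) / 2 := by
  have hpi := Real.pi_pos
  have hl := abs_pos.2 hlam.ne
  have h := summable_of_sum_range_le (fun k => by positivity)
    (sum_range_le_of_density_le hT hlam hM)
  rw [summable_mul_left_iff (by positivity)] at h
  rw [← Real.summable_one_div_nat_rpow, ← summable_nat_add_iff 1]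
  simpa using h

end Integral

lemma riemannZeta_ofReal_re {s : ℝ} (hs : 1 < s) :
    (riemannZeta s).re = ∑' k : ℕ, 1 / (k + 1 : ℝ) ^ s := by
  rw [zeta_eq_tsum_one_div_nat_add_one_cpow (by simpa using hs), ← Complex.ofReal_re (∑' k : ℕ, _),
    Complex.ofReal_tsum]
  congr 2
  ext k
  rw [Complex.ofReal_div, Complex.ofReal_cpow (by positivity)]
  simp

lemma summable_one_div_nat_add_one_rpow {s : ℝ} (hs : 1 < s) :
    Summable fun k : ℕ => 1 / (k + 1 : ℝ) ^ s := by
  have := (summable_nat_add_iff 1).2 (Real.summable_one_div_nat_rpow.2 hs)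
  simpa using this

lemma isLUB_density {V : Type*} [NormedAddCommGroup V] [InnerProductSpace ℝ V]
    [FiniteDimensional ℝ V] [MeasurableSpace V] [BorelSpace V] [Nontrivial V] {T lam : ℝ}
    (hT : 0 < T) (hlam : lam < 0) (hs : 1 < (Module.finrank ℝ V : ℝ) / 2) :
    IsLUB (density V T lam '' {A | 0 < fugacityGap T lam A})
      ((2 * Real.pi * T) ^ ((Module.finrank ℝ V : ℝ) / 2) / |lam| *
        (riemannZeta (((Module.finrank ℝ V : ℝ) / 2 : ℝ) : ℂ)).re) := by
  have hpi := Real.pi_pos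
  have hl := abs_pos.2 hlam.ne
  rw [riemannZeta_ofReal_re hs, ← tsum_mul_left]
  constructor
  · rintro _ ⟨A, hA, rfl⟩
    refine hasSum_le (fun k => ?_) (hasSum_density hT hlam hA)
      ((summable_one_div_nat_add_one_rpow hs).mul_left _).hasSum
    have h1 := pow_le_one₀ (n := k + 1) (by positivity) (fugacity_lt_one hlam hA).le
    gcongr
  · intro M hM
    exact Real.tsum_le_of_sum_range_le (fun k => by positivity)
      (sum_range_le_of_density_le hT hlam fun A hA => hM ⟨A, hA, rfl⟩)

/-- `N(A) = ∫_{ℝ^d} (e^{(|p|²/2 - A)/T} + λ)⁻¹ dp` is strictly increasing on its natural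
domain `D`, with infimum `0`; its supremum is `n_d ζ(d/2)/|λ|` if `λ < 0` and `d ≥ 3`,
and `+∞` (i.e. `N` is unbounded above on `D`) otherwise.  Consequently each admissible
density `n` is attained at a unique `A ∈ D`. -/
theorem density_vs_chemical_potential (d : ℕ) (hd : 1 ≤ d) (T : ℝ) (hT : 0 < T)
    (lam : ℝ) (D : Set ℝ)
    (hD : D = if 0 ≤ lam then Set.univ else Set.Iio (-T * Real.log |lam|))
    (N : ℝ → ℝ)
    (hN : ∀ A : ℝ, N A = ∫ p : EuclideanSpace ℝ (Fin d),
      (Real.exp ((‖p‖ ^ 2 / 2 - A) / T) + lam)⁻¹) :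
    StrictMonoOn N D ∧
    IsGLB (N '' D) 0 ∧
    (lam < 0 ∧ 3 ≤ d → IsLUB (N '' D)
      ((2 * Real.pi * T) ^ ((d : ℝ) / 2) * (riemannZeta ((d : ℂ) / 2)).re / |lam|)) ∧
    (¬ (lam < 0 ∧ 3 ≤ d) → ¬ BddAbove (N '' D)) ∧
    (∀ n : ℝ, 0 < n →
      (lam < 0 ∧ 3 ≤ d →
        n < (2 * Real.pi * T) ^ ((d : ℝ) / 2) * (riemannZeta ((d : ℂ) / 2)).re / |lam|) →
      ∃! A : ℝ, A ∈ D ∧ N A = n) := by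
  have hDgap : D = {A | 0 < fugacityGap T lam A} := by
    ext A
    rw [hD, ← fugacityGap_pos_iff hT, mem_ofPred_eq]
  have hconn : IsPreconnected D := by
    rw [hD]
    split_ifs
    exacts [isPreconnected_univ, isPreconnected_Iio]
  obtain rfl : N = density (EuclideanSpace ℝ (Fin d)) T lam := funext hN
  clear hD hN
  subst hDgap
  have : Nonempty (Fin d) := ⟨⟨0, hd⟩⟩
  have hfin : Module.finrank ℝ (EuclideanSpace ℝ (Fin d)) = d := finrank_euclideanSpace_fin
  set V := EuclideanSpace ℝ (Fin d)
  have hmono : StrictMonoOn (density V T lam) {A | 0 < fugacityGap T lam A} :=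
    fun A _ B hB h => density_lt hT hB h
  have hglb : IsGLB (density V T lam '' {A | 0 < fugacityGap T lam A}) 0 := by
    constructor
    · rintro _ ⟨A, hA, rfl⟩
      exact (density_pos hT hA).le
    · intro b hb
      by_contra! h
      obtain ⟨A, hA, hlt⟩ := exists_density_lt (V := V) (lam := lam) hT h
      exact (hb ⟨A, hA, rfl⟩).not_gt hlt
  have hlub (h : lam < 0 ∧ 3 ≤ d) : IsLUB (density V T lam '' {A | 0 < fugacityGap T lam A})
      ((2 * Real.pi * T) ^ ((d : ℝ) / 2) * (riemannZeta ((d : ℂ) / 2)).re / |lam|) := by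
    have h3 : (3 : ℝ) ≤ d := by exact_mod_cast h.2
    have := isLUB_density (V := V) hT h.1 (by rw [hfin]; linarith)
    rw [hfin] at this
    convert this using 1
    push_cast
    ring
  have hunb (h : ¬ (lam < 0 ∧ 3 ≤ d)) :
      ¬ BddAbove (density V T lam '' {A | 0 < fugacityGap T lam A}) := by
    rintro ⟨M, hM⟩
    rcases le_or_gt 0 lam with hl | hl
    · obtain ⟨A, hA, hlt⟩ := exists_lt_density_of_nonneg (V := V) hT hl M
      exact (hM ⟨A, hA, rfl⟩).not_gt hlt
    · have h1 := one_lt_half_finrank_of_density_le (V := V) hT hl fun A hA => hM ⟨A, hA, rfl⟩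
      rw [hfin, lt_div_iff₀ two_pos] at h1
      have h2 : 2 < d := by exact_mod_cast (one_mul (2 : ℝ) ▸ h1)
      exact h ⟨hl, h2⟩
  refine ⟨hmono, hglb, hlub, hunb, fun n hn hn' => ?_⟩
  obtain ⟨A, hA, hAn⟩ := exists_density_lt (V := V) (lam := lam) hT hn
  obtain ⟨B, hB, hBn⟩ : ∃ B, 0 < fugacityGap T lam B ∧ n < density V T lam B := by
    by_cases h : lam < 0 ∧ 3 ≤ d
    · obtain ⟨_, ⟨B, hB, rfl⟩, hlt⟩ := (lt_isLUB_iff (hlub h)).1 (hn' h)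
      exact ⟨B, hB, hlt⟩
    · obtain ⟨_, ⟨B, hB, rfl⟩, hlt⟩ := not_bddAbove_iff.1 (hunb h) n
      exact ⟨B, hB, hlt⟩
  obtain ⟨C, hC, hCn⟩ := hconn.intermediate_value hA hB
    (fun A hA => (continuousAt_density hT hA).continuousWithinAt) ⟨hAn.le, hBn.le⟩
  exact ⟨C, ⟨hC, hCn⟩, fun C' hC' => hmono.injOn hC'.1 hC (hC'.2.trans hCn.symm)⟩
end

section
/- Let λ < 0 and let s > 1 be real. Then the limit of φ_s(z) := (1/Γ(s)) ∫₀^∞ t^{s−1}/(e^{t−z} + λ) dt as z tends to −log|λ| from the left exists and equals ζ(s)/|λ|, where ζ is the Riemann zeta function. In particular, for λ = −1, lim_{z→0⁻} (1/Γ(s)) ∫₀^∞ t^{s−1}/(e^{t−z} − 1) dt = ζ(s). -/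
open MeasureTheory Filter Set

/-- `φ_s(z) = (1/Γ(s)) ∫₀^∞ t^{s-1}/(e^{t-z} + λ) dt`. -/
noncomputable def phiFun (lam s : ℝ) (z : ℝ) : ℝ :=
  (1 / Real.Gamma s) * ∫ t in Set.Ioi (0 : ℝ), t ^ (s - 1) / (Real.exp (t - z) + lam)

/-- The geometric expansion of the Bose kernel `1 / (e^t - 1)`. -/
lemma hasSum_exp_neg_succ_mul {t : ℝ} (ht : 0 < t) :
    HasSum (fun n : ℕ ↦ Real.exp (-((n : ℝ) + 1) * t)) (1 / (Real.exp t - 1)) := by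
  have h1 : Real.exp (-t) < 1 := by simpa using ht
  have h := (hasSum_geometric_of_lt_one (Real.exp_pos (-t)).le h1).mul_left (Real.exp (-t))
  convert! h using 1
  · funext n
    rw [← Real.exp_nat_mul, ← Real.exp_add]
    ring_nf
  · have h2 : Real.exp t - 1 ≠ 0 := by linarith [Real.add_one_lt_exp ht.ne']
    rw [Real.exp_neg] at h1 ⊢
    have h3 : 1 - (Real.exp t)⁻¹ ≠ 0 := by linarith
    field_simp

/-- The Bose integral: the Mellin transform of `1 / (e^t - 1)` is `Γ(s) ζ(s)`. -/
lemma integral_rpow_div_exp_sub_one {s : ℝ} (hs : 1 < s) :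
    ((∫ t in Ioi (0 : ℝ), t ^ (s - 1) / (Real.exp t - 1) : ℝ) : ℂ) =
      Complex.Gamma s * riemannZeta s := by
  have hs' : 1 < (s : ℂ).re := by simpa using hs
  have hsummable : Summable fun n : ℕ ↦ 1 / ((n : ℝ) + 1) ^ s := by
    simpa using (summable_nat_add_iff 1).2 (Real.summable_one_div_nat_rpow.2 hs)
  have h := hasSum_mellin (a := fun _ : ℕ ↦ 1) (p := fun n ↦ (n : ℝ) + 1)
    (F := fun t ↦ ((1 / (Real.exp t - 1) : ℝ) : ℂ)) (s := (s : ℂ))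
    (fun n ↦ Or.inr (by positivity)) (by simp; linarith)
    (fun t ht ↦ by
      simpa using Complex.hasSum_ofReal.2 (hasSum_exp_neg_succ_mul ht))
    (by simpa using hsummable)
  have hmellin : mellin (fun t ↦ ((1 / (Real.exp t - 1) : ℝ) : ℂ)) s =
      ((∫ t in Ioi (0 : ℝ), t ^ (s - 1) / (Real.exp t - 1) : ℝ) : ℂ) := by
    rw [mellin, ← integral_complex_ofReal]
    refine setIntegral_congr_fun measurableSet_Ioi fun t ht ↦ ?_
    simp [Complex.ofReal_cpow (le_of_lt ht), div_eq_mul_inv]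
  rw [← hmellin, ← h.tsum_eq, zeta_eq_tsum_one_div_nat_add_one_cpow hs', ← tsum_mul_left]
  simp [div_eq_mul_inv]

lemma integral_rpow_div_exp_sub_one_eq_re {s : ℝ} (hs : 1 < s) :
    ∫ t in Ioi (0 : ℝ), t ^ (s - 1) / (Real.exp t - 1) =
      Real.Gamma s * (riemannZeta s).re := by
  have h := congrArg Complex.re (integral_rpow_div_exp_sub_one hs)
  rwa [Complex.ofReal_re, Complex.Gamma_ofReal, Complex.re_ofReal_mul] at h

lemma integrableOn_rpow_div_exp_sub_one {s : ℝ} (hs : 1 < s) :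
    IntegrableOn (fun t : ℝ ↦ t ^ (s - 1) / (Real.exp t - 1)) (Ioi 0) := by
  by_contra hn
  have h := integral_rpow_div_exp_sub_one hs
  rw [integral_undef hn, Complex.ofReal_zero, eq_comm] at h
  exact mul_ne_zero (Complex.Gamma_ne_zero_of_re_pos (by simp; linarith))
    (riemannZeta_ne_zero_of_one_lt_re (by simpa using hs)) h

lemma tendsto_integral_rpow_div_exp_add {lam s : ℝ} (hlam : lam < 0) (hs : 1 < s) :
    Tendsto (fun z ↦ ∫ t in Ioi (0 : ℝ), t ^ (s - 1) / (Real.exp (t - z) + lam))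
      (nhdsWithin (-Real.log |lam|) (Iio (-Real.log |lam|)))
      (nhds (∫ t in Ioi (0 : ℝ), t ^ (s - 1) / (Real.exp t - 1) / |lam|)) := by
  have hpos : 0 < |lam| := abs_pos.2 hlam.ne
  have hexp (t : ℝ) : Real.exp (t - -Real.log |lam|) + lam = (Real.exp t - 1) * |lam| := by
    rw [sub_neg_eq_add, Real.exp_add, Real.exp_log hpos, abs_of_neg hlam]
    ring
  have hden {t : ℝ} (ht : 0 < t) : 0 < (Real.exp t - 1) * |lam| :=
    mul_pos (by linarith [Real.add_one_lt_exp ht.ne']) hpos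
  refine tendsto_integral_filter_of_dominated_convergence
    (fun t ↦ t ^ (s - 1) / (Real.exp t - 1) / |lam|) ?_ ?_
    ((integrableOn_rpow_div_exp_sub_one hs).div_const _) ?_
  · exact Eventually.of_forall fun z ↦ Measurable.aestronglyMeasurable (by fun_prop)
  · filter_upwards [self_mem_nhdsWithin] with z hz
    filter_upwards [ae_restrict_mem measurableSet_Ioi] with t ht
    have hle : (Real.exp t - 1) * |lam| ≤ Real.exp (t - z) + lam := by
      rw [← hexp]
      gcongr
      exact le_of_lt hz
    have htp : 0 ≤ t ^ (s - 1) := Real.rpow_nonneg (le_of_lt ht) _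
    rw [Real.norm_of_nonneg (div_nonneg htp ((hden ht).le.trans hle)), div_div]
    exact div_le_div_of_nonneg_left htp (hden ht) hle
  · filter_upwards [ae_restrict_mem measurableSet_Ioi] with t ht
    rw [div_div, ← hexp]
    have hne : Real.exp (t - -Real.log |lam|) + lam ≠ 0 := hexp t ▸ (hden ht).ne'
    have hc : ContinuousAt (fun z ↦ t ^ (s - 1) / (Real.exp (t - z) + lam))
        (-Real.log |lam|) := ContinuousAt.div (by fun_prop) (by fun_prop) hne
    exact hc.tendsto.mono_left nhdsWithin_le_nhds

/-- For `λ < 0` and `s > 1`, `φ_s(z) → ζ(s)/|λ|` as `z → (-log|λ|)⁻`.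
In particular, for `λ = -1`, `φ_s(z) → ζ(s)` as `z → 0⁻`. -/
theorem phi_tendsto_zeta (lam s : ℝ) (hlam : lam < 0) (hs : 1 < s) :
    Filter.Tendsto (phiFun lam s)
      (nhdsWithin (-Real.log |lam|) (Set.Iio (-Real.log |lam|)))
      (nhds ((riemannZeta (s : ℂ)).re / |lam|)) := by
  have h := (tendsto_integral_rpow_div_exp_add hlam hs).const_mul (1 / Real.Gamma s)
  have hG : Real.Gamma s ≠ 0 := (Real.Gamma_pos_of_pos (by linarith)).ne'
  rw [integral_div, integral_rpow_div_exp_sub_one_eq_re hs] at h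
  convert! h using 2
  field_simp
end

section
/- Let λ ∈ ℝ and let s > 0 be real. Then e^{−z}·φ_s(z) tends to 1 as z → −∞ (note that for λ < 0 the domain condition λ·e^z > −1 holds for all sufficiently negative z). -/
open MeasureTheory Filter Set

/-- For any `λ` and `s > 0`, `e^{-z} φ_s(z) → 1` as `z → -∞`
(the domain condition `λ e^z > -1` holds for all sufficiently negative `z`). -/
theorem phi_asymptotic_atBot (lam s : ℝ) (hs : 0 < s) :
    Filter.Tendsto (fun z : ℝ => Real.exp (-z) * phiFun lam s z)
      Filter.atBot (nhds 1) := by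
  have hΓ : Real.Gamma s ≠ 0 := (Real.Gamma_pos_of_pos hs).ne'
  have heq (z : ℝ) : Real.exp (-z) * phiFun lam s z =
      (1 / Real.Gamma s) *
        ∫ t in Ioi (0 : ℝ), t ^ (s - 1) / (Real.exp t + lam * Real.exp z) := by
    rw [phiFun, mul_left_comm, ← integral_const_mul]
    congr 2
    funext t
    have hden : Real.exp t + lam * Real.exp z =
        Real.exp z * (Real.exp (t - z) + lam) := by
      rw [mul_add, ← Real.exp_add, add_sub_cancel, mul_comm lam]
    rw [hden, Real.exp_neg, div_mul_eq_div_div, div_eq_mul_inv _ (Real.exp z),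
      mul_comm _ (Real.exp z)⁻¹, mul_div_assoc]
  have hlim : Tendsto (fun z : ℝ => lam * Real.exp z) atBot (nhds 0) := by
    simpa using Real.tendsto_exp_atBot.const_mul lam
  have hI : Tendsto
      (fun z : ℝ => ∫ t in Ioi (0 : ℝ), t ^ (s - 1) / (Real.exp t + lam * Real.exp z))
      atBot (nhds (∫ t in Ioi (0 : ℝ), Real.exp (-t) * t ^ (s - 1))) := by
    refine tendsto_integral_filter_of_dominated_convergence
      (fun t => 2 * (Real.exp (-t) * t ^ (s - 1))) ?_ ?_
      ((Real.GammaIntegral_convergent hs).const_mul 2) ?_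
    · exact Eventually.of_forall fun z => by
        apply Measurable.aestronglyMeasurable
        fun_prop
    · have hev : ∀ᶠ z : ℝ in atBot, -(1 / 2) < lam * Real.exp z :=
        hlim.eventually_const_lt (by norm_num)
      filter_upwards [hev] with z hz
      filter_upwards [ae_restrict_mem measurableSet_Ioi] with t ht
      have ht0 : (0 : ℝ) < t := ht
      have h1 : 1 ≤ Real.exp t := Real.one_le_exp ht0.le
      have hden : Real.exp t / 2 ≤ Real.exp t + lam * Real.exp z := by linarith
      have hpow : 0 ≤ t ^ (s - 1) := Real.rpow_nonneg ht0.le _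
      rw [Real.norm_of_nonneg (div_nonneg hpow (by linarith))]
      calc t ^ (s - 1) / (Real.exp t + lam * Real.exp z)
          ≤ t ^ (s - 1) / (Real.exp t / 2) :=
            div_le_div_of_nonneg_left hpow (by positivity) hden
        _ = 2 * (Real.exp (-t) * t ^ (s - 1)) := by
            rw [Real.exp_neg]
            field_simp
    · refine Eventually.of_forall fun t => ?_
      have h : Tendsto (fun z : ℝ => t ^ (s - 1) / (Real.exp t + lam * Real.exp z)) atBot
          (nhds (t ^ (s - 1) / (Real.exp t + 0))) :=
        tendsto_const_nhds.div (hlim.const_add _) (by simp)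
      rwa [add_zero, div_eq_inv_mul, ← Real.exp_neg] at h
  simp only [heq]
  rw [← Real.Gamma_eq_integral hs] at hI
  have h := hI.const_mul (1 / Real.Gamma s)
  rwa [one_div_mul_cancel hΓ] at h
end

section
/- Let s > 0 be real and z ∈ ℝ be fixed. Writing φ_s^{(λ)}(z) := (1/Γ(s)) ∫₀^∞ t^{s−1}/(e^{t−z} + λ) dt for those λ with λ·e^z > −1, one has lim_{λ→0} φ_s^{(λ)}(z) = e^z. -/
open MeasureTheory Filter Set

/-- If `λ > -e^{-z}/2`, the integrand of `phiFun` is dominated on `t > 0` by a multiple of the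
Gamma integrand. -/
theorem norm_rpow_div_exp_add_le {lam s z t : ℝ} (hlam : -(Real.exp (-z) / 2) < lam)
    (ht : 0 < t) :
    ‖t ^ (s - 1) / (Real.exp (t - z) + lam)‖ ≤
      2 * Real.exp z * (Real.exp (-t) * t ^ (s - 1)) := by
  have hexp : Real.exp (-z) ≤ Real.exp (t - z) := Real.exp_le_exp.mpr (by linarith)
  have hpos : 0 < Real.exp (t - z) := Real.exp_pos _
  have hhalf : Real.exp (t - z) / 2 ≤ Real.exp (t - z) + lam := by linarith
  have hrpow : 0 ≤ t ^ (s - 1) := Real.rpow_nonneg ht.le _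
  rw [Real.norm_of_nonneg (div_nonneg hrpow (by linarith))]
  calc t ^ (s - 1) / (Real.exp (t - z) + lam)
      ≤ t ^ (s - 1) / (Real.exp (t - z) / 2) := by gcongr
    _ = 2 * Real.exp z * (Real.exp (-t) * t ^ (s - 1)) := by
      rw [Real.exp_sub, Real.exp_neg]
      field_simp

/-- At `λ = 0`, `phiFun` is the exponential function. -/
theorem phiFun_zero {s : ℝ} (hs : 0 < s) (z : ℝ) : phiFun 0 s z = Real.exp z := by
  have hint : ∀ t : ℝ, t ^ (s - 1) / (Real.exp (t - z) + 0) =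
      Real.exp z * (Real.exp (-t) * t ^ (s - 1)) := fun t => by
    rw [add_zero, Real.exp_sub, Real.exp_neg]
    field_simp
  have hGamma := (Real.Gamma_pos_of_pos hs).ne'
  simp_rw [phiFun, hint]
  rw [integral_const_mul, ← Real.Gamma_eq_integral hs]
  field_simp

/-- Maxwell-Boltzmann limit: for fixed `s > 0` and `z`, `φ_s^{(λ)}(z) → e^z` as `λ → 0`. -/
theorem phi_MaxwellBoltzmann_limit (s z : ℝ) (hs : 0 < s) :
    Filter.Tendsto (fun lam : ℝ => phiFun lam s z) (nhds 0) (nhds (Real.exp z)) := by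
  rw [← phiFun_zero hs z]
  refine Tendsto.const_mul _ (tendsto_integral_filter_of_dominated_convergence
    (fun t => 2 * Real.exp z * (Real.exp (-t) * t ^ (s - 1))) ?_ ?_
    ((Real.GammaIntegral_convergent hs).const_mul _) ?_)
  · exact Eventually.of_forall fun lam => Measurable.aestronglyMeasurable (by fun_prop)
  · have hneg : -(Real.exp (-z) / 2) < 0 := by linarith [Real.exp_pos (-z)]
    filter_upwards [lt_mem_nhds hneg] with lam hlam
    filter_upwards [ae_restrict_mem measurableSet_Ioi] with t ht
    exact norm_rpow_div_exp_add_le hlam ht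
  · refine Eventually.of_forall fun t => ?_
    exact tendsto_const_nhds.div (tendsto_const_nhds.add tendsto_id)
      (by rw [add_zero]; exact (Real.exp_pos _).ne')
end

section
/- Let s > 0 be real and define the Fermi integral F_s(z) := (1/Γ(s)) ∫₀^∞ t^{s−1}/(e^{t−z} + 1) dt for z ∈ ℝ. Then Γ(s+1)·F_s(z)/z^s tends to 1 as z → +∞. -/
open MeasureTheory Filter Set

/-- The Fermi integral `F_s(z) = (1/Γ(s)) ∫₀^∞ t^{s-1}/(e^{t-z} + 1) dt`. -/
noncomputable def fermiF (s : ℝ) (z : ℝ) : ℝ :=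
  (1 / Real.Gamma s) * ∫ t in Set.Ioi (0 : ℝ), t ^ (s - 1) / (Real.exp (t - z) + 1)

/-- Rescaling the Fermi integral by `t = z u`. -/
theorem fermi_integral_eq_rpow_mul (s : ℝ) {z : ℝ} (hz : 0 < z) :
    ∫ t in Ioi (0 : ℝ), t ^ (s - 1) / (Real.exp (t - z) + 1) =
      z ^ s * ∫ u in Ioi (0 : ℝ), u ^ (s - 1) / (Real.exp (z * (u - 1)) + 1) := by
  have h := integral_comp_mul_left_Ioi
    (fun t : ℝ => t ^ (s - 1) / (Real.exp (t - z) + 1)) 0 hz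
  rw [mul_zero, smul_eq_mul, eq_inv_mul_iff_mul_eq₀ hz.ne'] at h
  rw [← h, ← integral_const_mul, ← integral_const_mul]
  refine setIntegral_congr_fun measurableSet_Ioi fun u hu => ?_
  have hu : 0 < u := hu
  rw [Real.mul_rpow hz.le hu.le, Real.rpow_sub_one hz.ne', mul_sub, mul_one]
  field_simp

/-- As `z → ∞`, the Fermi weight `1 / (e^{z(u-1)} + 1)` converges, away from `u = 1`,
to the indicator function of `u < 1`. -/
theorem tendsto_fermi_weight {u : ℝ} (hu : u ≠ 1) (c : ℝ) :
    Tendsto (fun z : ℝ => c / (Real.exp (z * (u - 1)) + 1)) atTop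
      (nhds ((Iio (1 : ℝ)).indicator (fun _ => c) u)) := by
  rcases lt_or_gt_of_ne hu with h | h
  · rw [indicator_of_mem (mem_Iio.2 h)]
    have h1 : Tendsto (fun z : ℝ => Real.exp (z * (u - 1))) atTop (nhds 0) :=
      Real.tendsto_exp_atBot.comp (tendsto_id.atTop_mul_const_of_neg (sub_neg.2 h))
    have h2 := (tendsto_const_nhds (x := c)).div (h1.add_const 1) (by norm_num)
    rwa [zero_add, div_one] at h2
  · rw [indicator_of_notMem (by simpa using h.le)]
    have h1 : Tendsto (fun z : ℝ => Real.exp (z * (u - 1))) atTop atTop :=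
      Real.tendsto_exp_atTop.comp (tendsto_id.atTop_mul_const (sub_pos.2 h))
    exact tendsto_const_nhds.div_atTop (tendsto_atTop_add_const_right _ 1 h1)

/-- For `z ≥ 1` the Fermi weight is dominated by a multiple of `e^{-u}`. -/
theorem inv_exp_mul_sub_one_add_one_le (u : ℝ) {z : ℝ} (hz : 1 ≤ z) :
    (Real.exp (z * (u - 1)) + 1)⁻¹ ≤ Real.exp 1 * Real.exp (-u) := by
  rw [← Real.exp_add, show 1 + -u = -(u - 1) by ring, Real.exp_neg]
  refine inv_anti₀ (Real.exp_pos _) ?_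
  rcases le_total u 1 with h | h
  · have := Real.exp_le_one_iff.2 (sub_nonpos.2 h)
    have := Real.exp_pos (z * (u - 1))
    linarith
  · have := Real.exp_le_exp.2 (le_mul_of_one_le_left (sub_nonneg.2 h) hz)
    linarith

theorem tendsto_integral_fermi_weight {s : ℝ} (hs : 0 < s) :
    Tendsto (fun z : ℝ => ∫ u in Ioi (0 : ℝ), u ^ (s - 1) / (Real.exp (z * (u - 1)) + 1))
      atTop (nhds s⁻¹) := by
  have hlim : ∫ u in Ioi (0 : ℝ), (Iio (1 : ℝ)).indicator (fun _ => u ^ (s - 1)) u = s⁻¹ := by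
    have hind : (fun u : ℝ => (Iio (1 : ℝ)).indicator (fun _ => u ^ (s - 1)) u) =
        (Iio (1 : ℝ)).indicator fun u => u ^ (s - 1) := rfl
    rw [hind, setIntegral_indicator measurableSet_Iio, Ioi_inter_Iio, ← integral_Ioc_eq_integral_Ioo,
      ← intervalIntegral.integral_of_le zero_le_one, integral_rpow (Or.inl (by linarith))]
    simp [hs.ne']
  rw [← hlim]
  refine tendsto_integral_filter_of_dominated_convergence
    (fun u => Real.exp 1 * (Real.exp (-u) * u ^ (s - 1))) ?_ ?_
    ((Real.GammaIntegral_convergent hs).const_mul _) ?_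
  · exact .of_forall fun z => Measurable.aestronglyMeasurable (by fun_prop)
  · filter_upwards [eventually_ge_atTop 1] with z hz
    filter_upwards [ae_restrict_mem measurableSet_Ioi] with u hu
    have hp : 0 ≤ u ^ (s - 1) := Real.rpow_nonneg (le_of_lt hu) _
    rw [Real.norm_of_nonneg (by positivity), div_eq_mul_inv, ← mul_assoc, mul_comm]
    exact mul_le_mul_of_nonneg_right (inv_exp_mul_sub_one_add_one_le u hz) hp
  · filter_upwards [ae_restrict_of_ae (Measure.ae_ne volume (1 : ℝ))] with u hu
    exact tendsto_fermi_weight hu _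

/-- Sommerfeld asymptotics: `F_s(z) ~ z^s / Γ(s+1)` as `z → +∞`, i.e.
`Γ(s+1) F_s(z)/z^s → 1`. -/
theorem fermi_asymptotic_atTop (s : ℝ) (hs : 0 < s) :
    Filter.Tendsto (fun z : ℝ => Real.Gamma (s + 1) * fermiF s z / z ^ s)
      Filter.atTop (nhds 1) := by
  have h := (tendsto_integral_fermi_weight hs).const_mul s
  rw [mul_inv_cancel₀ hs.ne'] at h
  refine h.congr' ?_
  filter_upwards [eventually_gt_atTop 0] with z hz
  have hG := (Real.Gamma_pos_of_pos hs).ne'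
  have hzs := (Real.rpow_pos_of_pos hz s).ne'
  rw [fermiF, fermi_integral_eq_rpow_mul s hz, Real.Gamma_add_one hs.ne']
  field_simp
end

section
/- Let 0 < s < 1 be real and define the Bose integral B_s(z) := (1/Γ(s)) ∫₀^∞ t^{s−1}/(e^{t−z} − 1) dt for z < 0. Then (−z)^{1−s}·B_s(z)/Γ(1−s) tends to 1 as z → 0⁻. -/
open MeasureTheory Filter Set

/-- The Bose integral `B_s(z) = (1/Γ(s)) ∫₀^∞ t^{s-1}/(e^{t-z} - 1) dt`, for `z < 0`. -/
noncomputable def boseB (s : ℝ) (z : ℝ) : ℝ :=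
  (1 / Real.Gamma s) * ∫ t in Set.Ioi (0 : ℝ), t ^ (s - 1) / (Real.exp (t - z) - 1)

lemma lintegral_rpow_mul_exp_neg_mul_Ioi {a r : ℝ} (ha : 0 < a) (hr : 0 < r) :
    ∫⁻ t in Ioi (0 : ℝ), ENNReal.ofReal (t ^ (a - 1) * Real.exp (-(r * t))) =
      ENNReal.ofReal ((1 / r) ^ a * Real.Gamma a) := by
  have hval := Real.integral_rpow_mul_exp_neg_mul_Ioi ha hr
  have hpos : 0 < (1 / r) ^ a * Real.Gamma a :=
    mul_pos (Real.rpow_pos_of_pos (by positivity) _) (Real.Gamma_pos_of_pos ha)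
  rw [← hval]
  refine (ofReal_integral_eq_lintegral_ofReal ?_ ?_).symm
  · by_contra h
    rw [integral_undef h] at hval
    exact hpos.ne hval
  · filter_upwards [ae_restrict_mem measurableSet_Ioi] with t ht
    have : 0 < t := ht
    positivity

lemma lintegral_rpow_div_one_add_Ioi {s : ℝ} (hs0 : 0 < s) (hs1 : s < 1) :
    ∫⁻ u in Ioi (0 : ℝ), ENNReal.ofReal (u ^ (s - 1) / (1 + u)) =
      ENNReal.ofReal (Real.Gamma s * Real.Gamma (1 - s)) := by
  calc ∫⁻ u in Ioi (0 : ℝ), ENNReal.ofReal (u ^ (s - 1) / (1 + u))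
      = ∫⁻ u in Ioi (0 : ℝ), ∫⁻ v in Ioi (0 : ℝ),
          ENNReal.ofReal (u ^ (s - 1) * Real.exp (-((1 + u) * v))) := by
        refine setLIntegral_congr_fun measurableSet_Ioi fun u hu => ?_
        have hu : 0 < u := hu
        have h := lintegral_rpow_mul_exp_neg_mul_Ioi one_pos (show 0 < 1 + u by positivity)
        simp only [sub_self, Real.rpow_zero, one_mul, Real.rpow_one, Real.Gamma_one, mul_one] at h
        have hu' : 0 ≤ u ^ (s - 1) := by positivity
        simp only [ENNReal.ofReal_mul hu']
        rw [lintegral_const_mul _ (by fun_prop), h, ← ENNReal.ofReal_mul hu', mul_one_div]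
    _ = ∫⁻ v in Ioi (0 : ℝ), ∫⁻ u in Ioi (0 : ℝ),
          ENNReal.ofReal (u ^ (s - 1) * Real.exp (-((1 + u) * v))) :=
        lintegral_lintegral_swap (by fun_prop)
    _ = ∫⁻ v in Ioi (0 : ℝ), ENNReal.ofReal (Real.Gamma s) *
          ENNReal.ofReal (v ^ ((1 - s) - 1) * Real.exp (-(1 * v))) := by
        refine setLIntegral_congr_fun measurableSet_Ioi fun v hv => ?_
        have hv : 0 < v := hv
        have hsplit : ∀ u : ℝ, ENNReal.ofReal (u ^ (s - 1) * Real.exp (-((1 + u) * v))) =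
            ENNReal.ofReal (Real.exp (-v)) *
              ENNReal.ofReal (u ^ (s - 1) * Real.exp (-(v * u))) := fun u => by
          rw [← ENNReal.ofReal_mul (Real.exp_pos _).le, mul_left_comm, ← Real.exp_add]
          ring_nf
        simp only [hsplit]
        rw [lintegral_const_mul _ (by fun_prop), lintegral_rpow_mul_exp_neg_mul_Ioi hs0 hv,
          ← ENNReal.ofReal_mul (Real.exp_pos _).le,
          ← ENNReal.ofReal_mul (Real.Gamma_pos_of_pos hs0).le, one_div,
          Real.inv_rpow hv.le, ← Real.rpow_neg hv.le]
        ring_nf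
    _ = ENNReal.ofReal (Real.Gamma s * Real.Gamma (1 - s)) := by
        rw [lintegral_const_mul _ (by fun_prop),
          lintegral_rpow_mul_exp_neg_mul_Ioi (sub_pos.2 hs1) one_pos,
          ← ENNReal.ofReal_mul (Real.Gamma_pos_of_pos hs0).le]
        simp

lemma ae_nonneg_rpow_div_one_add (s : ℝ) :
    0 ≤ᵐ[volume.restrict (Ioi (0 : ℝ))] fun u : ℝ => u ^ (s - 1) / (1 + u) := by
  filter_upwards [ae_restrict_mem measurableSet_Ioi] with u hu
  have : 0 < u := hu
  positivity

lemma integrableOn_rpow_div_one_add_Ioi {s : ℝ} (hs0 : 0 < s) (hs1 : s < 1) :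
    IntegrableOn (fun u : ℝ => u ^ (s - 1) / (1 + u)) (Ioi 0) := by
  refine (lintegral_ofReal_ne_top_iff_integrable
    (Measurable.aestronglyMeasurable (by fun_prop)) (ae_nonneg_rpow_div_one_add s)).1 ?_
  rw [lintegral_rpow_div_one_add_Ioi hs0 hs1]
  exact ENNReal.ofReal_ne_top

lemma integral_rpow_div_one_add_Ioi {s : ℝ} (hs0 : 0 < s) (hs1 : s < 1) :
    ∫ u in Ioi (0 : ℝ), u ^ (s - 1) / (1 + u) = Real.Gamma s * Real.Gamma (1 - s) := by
  rw [integral_eq_lintegral_of_nonneg_ae (ae_nonneg_rpow_div_one_add s)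
    (Measurable.aestronglyMeasurable (by fun_prop)), lintegral_rpow_div_one_add_Ioi hs0 hs1,
    ENNReal.toReal_ofReal (mul_pos (Real.Gamma_pos_of_pos hs0)
      (Real.Gamma_pos_of_pos (sub_pos.2 hs1))).le]

lemma rpow_mul_integral_bose_eq {s a : ℝ} (ha : 0 < a) :
    a ^ (1 - s) * ∫ t in Ioi (0 : ℝ), t ^ (s - 1) / (Real.exp (t + a) - 1) =
      ∫ u in Ioi (0 : ℝ), u ^ (s - 1) * (a / (Real.exp (a * (1 + u)) - 1)) := by
  have h := integral_comp_mul_left_Ioi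
    (fun t : ℝ => t ^ (s - 1) / (Real.exp (t + a) - 1)) 0 ha
  rw [mul_zero, smul_eq_mul, eq_inv_mul_iff_mul_eq₀ ha.ne'] at h
  rw [← h, ← mul_assoc, ← integral_const_mul]
  refine setIntegral_congr_fun measurableSet_Ioi fun u hu => ?_
  have hu : 0 < u := hu
  have hpow : a ^ (1 - s) * a ^ (s - 1) = 1 := by
    rw [← Real.rpow_add ha]; simp
  simp only [Real.mul_rpow ha.le hu.le]
  rw [show a * u + a = a * (1 + u) by ring]
  linear_combination a * u ^ (s - 1) / (Real.exp (a * (1 + u)) - 1) * hpow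

lemma tendsto_div_exp_mul_sub_one {c : ℝ} (hc : c ≠ 0) :
    Tendsto (fun a : ℝ => a / (Real.exp (a * c) - 1)) (nhdsWithin 0 (Ioi 0)) (nhds (1 / c)) := by
  have hd : HasDerivAt (fun a : ℝ => Real.exp (a * c)) c 0 := by
    simpa using ((hasDerivAt_id (0 : ℝ)).mul_const c).exp
  have h := (hd.tendsto_slope.mono_left
    (nhdsWithin_mono 0 fun x (hx : 0 < x) => hx.ne')).inv₀ hc
  rw [one_div]
  refine h.congr fun a => ?_
  simp [slope_def_field]

lemma tendsto_integral_bose_rescaled {s : ℝ} (hs0 : 0 < s) (hs1 : s < 1) :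
    Tendsto (fun a : ℝ => ∫ u in Ioi (0 : ℝ), u ^ (s - 1) * (a / (Real.exp (a * (1 + u)) - 1)))
      (nhdsWithin 0 (Ioi 0)) (nhds (Real.Gamma s * Real.Gamma (1 - s))) := by
  rw [← integral_rpow_div_one_add_Ioi hs0 hs1]
  refine tendsto_integral_filter_of_dominated_convergence
    (fun u : ℝ => u ^ (s - 1) / (1 + u)) ?_ ?_ (integrableOn_rpow_div_one_add_Ioi hs0 hs1) ?_
  · exact Eventually.of_forall fun a => Measurable.aestronglyMeasurable (by fun_prop)
  · filter_upwards [self_mem_nhdsWithin] with a ha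
    filter_upwards [ae_restrict_mem measurableSet_Ioi] with u hu
    have ha : 0 < a := ha
    have hu : 0 < u := hu
    have hexp : a * (1 + u) ≤ Real.exp (a * (1 + u)) - 1 := by
      linarith [Real.add_one_le_exp (a * (1 + u))]
    have hpos : 0 < a * (1 + u) := by positivity
    have hden : 0 < Real.exp (a * (1 + u)) - 1 := hpos.trans_le hexp
    rw [Real.norm_of_nonneg (by positivity), div_eq_mul_one_div (u ^ (s - 1))]
    refine mul_le_mul_of_nonneg_left ?_ (by positivity)
    rw [div_le_div_iff₀ hden (by positivity), one_mul]
    exact hexp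
  · filter_upwards [ae_restrict_mem measurableSet_Ioi] with u hu
    have hu : 0 < u := hu
    rw [div_eq_mul_one_div (u ^ (s - 1))]
    exact (tendsto_div_exp_mul_sub_one (by positivity)).const_mul _

/-- For `0 < s < 1`, `B_s(z) ~ Γ(1-s)(-z)^{s-1}` as `z → 0⁻`, i.e.
`(-z)^{1-s} B_s(z)/Γ(1-s) → 1`. -/
theorem bose_asymptotic_zero (s : ℝ) (hs0 : 0 < s) (hs1 : s < 1) :
    Filter.Tendsto (fun z : ℝ => (-z) ^ (1 - s) * boseB s z / Real.Gamma (1 - s))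
      (nhdsWithin 0 (Set.Iio 0)) (nhds 1) := by
  have hG : Real.Gamma s * Real.Gamma (1 - s) ≠ 0 :=
    (mul_pos (Real.Gamma_pos_of_pos hs0) (Real.Gamma_pos_of_pos (sub_pos.2 hs1))).ne'
  have hneg : Tendsto (fun z : ℝ => -z) (nhdsWithin 0 (Iio 0)) (nhdsWithin 0 (Ioi 0)) := by
    simpa using tendsto_neg_nhdsLT (a := (0 : ℝ))
  have h := ((tendsto_integral_bose_rescaled hs0 hs1).comp hneg).div_const
    (Real.Gamma s * Real.Gamma (1 - s))
  rw [div_self hG] at h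
  refine h.congr' ?_
  filter_upwards [self_mem_nhdsWithin] with z hz
  have hz : 0 < -z := neg_pos.2 hz
  simp only [Function.comp_apply, ← rpow_mul_integral_bose_eq hz, boseB, ← sub_eq_add_neg]
  field_simp
end

section
/- Let d ≥ 1 be an integer, T > 0, A ∈ ℝ and λ ∈ ℝ with λ·e^{A/T} > −1, and let 1 ≤ i, j, k', l ≤ d be indices. Then ∫_{ℝ^d} q_i · q_j · q_{k'} · q_l · ((1/3)·F_1(q) − 2·F_2(q) + 2·F_3(q)) dq = (1/3)·(δ_{ij}δ_{k'l} + δ_{ik'}δ_{jl} + δ_{il}δ_{jk'}) · n_d · T² · φ_{d/2}'(A/T), where φ_{d/2}' is the derivative of the function z ↦ φ_{d/2}(z) := (1/Γ(d/2)) ∫₀^∞ t^{d/2−1}/(e^{t−z} + λ) dt (which is differentiable on the set where λ·e^z > −1), and δ is the Kronecker delta. -/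
open MeasureTheory Filter Set

/-- The Kronecker delta on `Fin d`. -/
noncomputable def kron {d : ℕ} (i j : Fin d) : ℝ := if i = j then 1 else 0

/-- The profile `x ↦ e^{kx} / (e^x + λ)^{k+1}`, of which `F_k` is the composition with `h`. -/
noncomputable def fermiProfile (lam : ℝ) (k : ℕ) (x : ℝ) : ℝ :=
  Real.exp (k * x) / (Real.exp x + lam) ^ (k + 1)

lemma exists_mul_exp_le_exp_add {lam z : ℝ} (hz : lam * Real.exp z > -1) :
    ∃ c > 0, ∀ x, -z ≤ x → c * Real.exp x ≤ Real.exp x + lam := by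
  refine ⟨min 1 (1 + lam * Real.exp z), lt_min one_pos (by linarith), fun x hx => ?_⟩
  have hx0 := Real.exp_pos x
  rcases le_total 0 lam with hl | hl
  · have := mul_le_mul_of_nonneg_right (min_le_left 1 (1 + lam * Real.exp z)) hx0.le
    linarith
  · have h1 := mul_le_mul_of_nonneg_right (min_le_right 1 (1 + lam * Real.exp z)) hx0.le
    have h2 : 1 ≤ Real.exp z * Real.exp x := by
      rw [← Real.exp_add]
      exact Real.one_le_exp (by linarith)
    nlinarith

lemma exp_add_pos_s15 {lam z : ℝ} (hz : lam * Real.exp z > -1) {x : ℝ} (hx : -z ≤ x) :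
    0 < Real.exp x + lam := by
  obtain ⟨c, hc, h⟩ := exists_mul_exp_le_exp_add hz
  exact (mul_pos hc (Real.exp_pos x)).trans_le (h x hx)

lemma exists_abs_fermiProfile_le {lam z : ℝ} (hz : lam * Real.exp z > -1) (k : ℕ) :
    ∃ C, ∀ x, -z ≤ x → |fermiProfile lam k x| ≤ C * Real.exp (-x) := by
  obtain ⟨c, hc, h⟩ := exists_mul_exp_le_exp_add hz
  refine ⟨(c ^ (k + 1))⁻¹, fun x hx => ?_⟩
  have hpos := exp_add_pos_s15 hz hx
  rw [fermiProfile, abs_of_pos (by positivity), div_le_iff₀ (by positivity)]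
  have hle := pow_le_pow_left₀ (by positivity) (h x hx) (k + 1)
  calc Real.exp (k * x)
      = (c ^ (k + 1))⁻¹ * Real.exp (-x) * (c * Real.exp x) ^ (k + 1) := by
        rw [mul_pow, ← Real.exp_nat_mul]
        have : Real.exp (k * x) = Real.exp (-x) * Real.exp ((k + 1 : ℕ) * x) := by
          rw [← Real.exp_add]; congr 1; push_cast; ring
        rw [this]
        field_simp
    _ ≤ _ := mul_le_mul_of_nonneg_left hle (by positivity)

lemma hasDerivAt_fermiProfile {lam x : ℝ} (hx : 0 < Real.exp x + lam) (k : ℕ) :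
    HasDerivAt (fermiProfile lam k)
      (k * fermiProfile lam k x - (k + 1) * fermiProfile lam (k + 1) x) x := by
  have h1 : HasDerivAt (fun y : ℝ => Real.exp (k * y)) (Real.exp (k * x) * k) x := by
    simpa using ((hasDerivAt_id x).const_mul (k : ℝ)).exp
  have h2 := ((Real.hasDerivAt_exp x).add_const lam).pow (k + 1)
  refine (h1.div h2 (pow_pos hx _).ne').congr_deriv ?_
  simp only [fermiProfile, Pi.pow_apply]
  have : Real.exp ((k + 1 : ℕ) * x) = Real.exp (k * x) * Real.exp x := by
    rw [← Real.exp_add]; congr 1; push_cast; ring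
  rw [this]
  push_cast
  field_simp
  ring

lemma continuousOn_fermiProfile {lam z : ℝ} (hz : lam * Real.exp z > -1) (k : ℕ) :
    ContinuousOn (fermiProfile lam k) (Ici (-z)) := fun _ hx =>
  (hasDerivAt_fermiProfile (exp_add_pos_s15 hz hx) k).continuousAt.continuousWithinAt

lemma exists_gt_mul_exp_gt {lam z : ℝ} (hz : lam * Real.exp z > -1) :
    ∃ w > z, lam * Real.exp w > -1 := by
  have hc : Continuous fun w => lam * Real.exp w := by fun_prop
  have h : ∀ᶠ w in nhds z, lam * Real.exp w > -1 := hc.continuousAt.eventually (lt_mem_nhds hz)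
  have h' : ∀ᶠ w in nhdsWithin z (Ioi z), lam * Real.exp w > -1 := h.filter_mono nhdsWithin_le_nhds
  obtain ⟨w, hw, hw'⟩ := (h'.and self_mem_nhdsWithin).exists
  exact ⟨w, hw', hw⟩

lemma integrableOn_rpow_mul_exp_sub {s : ℝ} (hs : 0 < s) (C w : ℝ) :
    IntegrableOn (fun t : ℝ => t ^ (s - 1) * (C * Real.exp (-(t - w)))) (Ioi 0) := by
  have h : IntegrableOn (fun t : ℝ => C * Real.exp w * (Real.exp (-t) * t ^ (s - 1))) (Ioi 0) :=
    (Real.GammaIntegral_convergent hs).const_mul _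
  refine h.congr_fun (fun t _ => ?_) measurableSet_Ioi
  have : Real.exp (-(t - w)) = Real.exp w * Real.exp (-t) := by
    rw [← Real.exp_add]; congr 1; ring
  simp only [this]
  ring

lemma aestronglyMeasurable_rpow_mul_fermiProfile {lam z : ℝ} (hz : lam * Real.exp z > -1)
    (s : ℝ) (k : ℕ) :
    AEStronglyMeasurable (fun t : ℝ => t ^ (s - 1) * fermiProfile lam k (t - z))
      (volume.restrict (Ioi 0)) := by
  refine ContinuousOn.aestronglyMeasurable ?_ measurableSet_Ioi
  refine ContinuousOn.mul (fun t ht => ?_) ?_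
  · exact (Real.continuousAt_rpow_const _ _ (Or.inl (ne_of_gt ht))).continuousWithinAt
  · refine (continuousOn_fermiProfile hz k).comp (by fun_prop) fun t ht => ?_
    have : 0 < t := ht
    simp only [mem_Ici]
    linarith

/-- Differentiation under the integral sign in `φ_s`. -/
lemma hasDerivAt_fermiI_one {lam s z : ℝ} (hs : 0 < s) (hz : lam * Real.exp z > -1) :
    HasDerivAt (fermiI lam s 1)
      ((1 / Real.Gamma s) * ∫ t in Ioi (0 : ℝ), t ^ (s - 1) * fermiProfile lam 1 (t - z)) z := by
  have key : fermiI lam s 1 = fun y => (1 / Real.Gamma s) *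
      ∫ t in Ioi (0 : ℝ), t ^ (s - 1) * fermiProfile lam 0 (t - y) := by
    ext y
    simp [fermiI, fermiProfile, div_eq_mul_inv]
  rw [key]
  refine HasDerivAt.const_mul _ ?_
  obtain ⟨w, hzw, hw⟩ := exists_gt_mul_exp_gt hz
  obtain ⟨C, hC⟩ := exists_abs_fermiProfile_le hw 1
  obtain ⟨C₀, hC₀⟩ := exists_abs_fermiProfile_le hz 0
  have hC_nonneg : 0 ≤ C := by
    have := (abs_nonneg _).trans (hC _ le_rfl)
    exact nonneg_of_mul_nonneg_left this (Real.exp_pos _)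
  have hlt : ∀ y < w, lam * Real.exp y > -1 := fun y hy => by
    rcases le_total 0 lam with hl | hl
    · have := mul_nonneg hl (Real.exp_pos y).le
      linarith
    · have := mul_le_mul_of_nonpos_left (Real.exp_le_exp.2 hy.le) hl
      linarith
  refine (hasDerivAt_integral_of_dominated_loc_of_deriv_le
    (F := fun y t => t ^ (s - 1) * fermiProfile lam 0 (t - y))
    (F' := fun y t => t ^ (s - 1) * fermiProfile lam 1 (t - y))
    (bound := fun t => t ^ (s - 1) * (C * Real.exp (-(t - w))))
    (Iio_mem_nhds hzw) ?_ ?_ ?_ ?_ ?_ ?_).2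
  · filter_upwards [Iio_mem_nhds hzw] with y hy
    exact aestronglyMeasurable_rpow_mul_fermiProfile (hlt y hy) s 0
  · refine (integrableOn_rpow_mul_exp_sub hs C₀ z).mono'
      (aestronglyMeasurable_rpow_mul_fermiProfile hz s 0) ?_
    filter_upwards [ae_restrict_mem measurableSet_Ioi] with t ht
    have ht' : 0 < t := ht
    rw [norm_mul, Real.norm_of_nonneg (Real.rpow_nonneg ht'.le _)]
    exact mul_le_mul_of_nonneg_left (hC₀ _ (by linarith)) (Real.rpow_nonneg ht'.le _)
  · exact aestronglyMeasurable_rpow_mul_fermiProfile hz s 1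
  · filter_upwards [ae_restrict_mem measurableSet_Ioi] with t ht y hy
    have ht' : 0 < t := ht
    have hy' : y < w := hy
    rw [norm_mul, Real.norm_of_nonneg (Real.rpow_nonneg ht'.le _)]
    refine mul_le_mul_of_nonneg_left ((hC _ (by linarith)).trans ?_) (Real.rpow_nonneg ht'.le _)
    exact mul_le_mul_of_nonneg_left (Real.exp_le_exp.2 (by linarith)) hC_nonneg
  · exact integrableOn_rpow_mul_exp_sub hs C w
  · filter_upwards [ae_restrict_mem measurableSet_Ioi] with t ht y hy
    have ht' : 0 < t := ht
    have hpos := exp_add_pos_s15 (hlt y hy) (x := t - y) (by linarith)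
    have h1 := (hasDerivAt_fermiProfile hpos 0).comp y ((hasDerivAt_id y).const_sub t)
    refine (h1.const_mul (t ^ (s - 1))).congr_deriv ?_
    simp

/-- Integration of a function of `‖q‖² / (2T)` over Euclidean space. -/
lemma integral_euclideanSpace_norm_sq_div {d : ℕ} (hd : 1 ≤ d) {T : ℝ} (hT : 0 < T)
    (f : ℝ → ℝ) :
    ∫ q : EuclideanSpace ℝ (Fin d), f (‖q‖ ^ 2 / (2 * T)) =
      (2 * Real.pi * T) ^ ((d : ℝ) / 2) *
        ((1 / Real.Gamma ((d : ℝ) / 2)) *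
          ∫ t in Ioi (0 : ℝ), t ^ ((d : ℝ) / 2 - 1) * f t) := by
  have hd0 : (0 : ℝ) < d := by exact_mod_cast hd
  have : Nonempty (Fin d) := ⟨⟨0, hd⟩⟩
  set s : ℝ := (d : ℝ) / 2 with hs
  have hs0 : 0 < s := by positivity
  have hball : (volume : Measure (EuclideanSpace ℝ (Fin d))).real (Metric.ball 0 1) =
      Real.pi ^ s / (s * Real.Gamma s) := by
    rw [Measure.real, EuclideanSpace.volume_ball]
    simp only [ENNReal.ofReal_one, one_pow, one_mul, Fintype.card_fin]
    rw [ENNReal.toReal_ofReal (by positivity), ← hs, Real.Gamma_add_one hs0.ne', Real.sqrt_eq_rpow,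
      ← Real.rpow_natCast, ← Real.rpow_mul Real.pi_pos.le]
    congr 2
    rw [hs]; ring
  have hradial : ∫ y in Ioi (0 : ℝ), y ^ (d - 1) • f (y ^ 2 / (2 * T)) =
      (2 * T) ^ s / 2 * ∫ t in Ioi (0 : ℝ), t ^ (s - 1) * f t := by
    have h1 := integral_comp_mul_left_Ioi' (fun t : ℝ => t ^ (s - 1) * f t) 0
      (b := (2 * T)⁻¹) (by positivity)
    rw [mul_zero] at h1
    rw [← h1, ← integral_comp_rpow_Ioi_of_pos
      (g := fun x : ℝ => ((2 * T)⁻¹ * x) ^ (s - 1) * f ((2 * T)⁻¹ * x)) two_pos, smul_eq_mul,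
      ← integral_const_mul,
      ← integral_const_mul]
    refine setIntegral_congr_fun measurableSet_Ioi fun y hy => ?_
    have hy' : 0 < y := hy
    simp only [smul_eq_mul, Real.rpow_two]
    have e1 : (2 * T)⁻¹ * y ^ 2 = y ^ 2 / (2 * T) := by ring
    have e2 : (y ^ 2) ^ (s - 1) * y = y ^ (d - 1) := by
      rw [← Real.rpow_natCast y 2, ← Real.rpow_mul hy'.le, ← Real.rpow_add_one hy'.ne',
        ← Real.rpow_natCast, Nat.cast_sub hd]
      congr 1
      rw [hs]; push_cast; ring
    have e3 : (2 * T) ^ s = (2 * T) ^ (s - 1) * (2 * T) := by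
      rw [← Real.rpow_add_one (by positivity)]; congr 1; ring
    have e4 : y ^ ((2 : ℝ) - 1) = y := by norm_num
    rw [e1, e4, Real.div_rpow (by positivity) (by positivity), e3, ← e2]
    field_simp
  rw [integral_fun_norm_addHaar volume (fun r => f (r ^ 2 / (2 * T))), hball,
    finrank_euclideanSpace, Fintype.card_fin, hradial]
  have e5 : (2 * Real.pi * T) ^ s = Real.pi ^ s * (2 * T) ^ s := by
    rw [← Real.mul_rpow Real.pi_pos.le (by positivity)]; congr 1; ring
  have hG := (Real.Gamma_pos_of_pos hs0).ne'
  have hd2 : (d : ℝ) = 2 * s := by rw [hs]; ring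
  rw [e5, nsmul_eq_mul, smul_eq_mul, hd2]
  field_simp

lemma neg_le_norm_sq_div_sub {d : ℕ} {T : ℝ} (hT : 0 < T) (z : ℝ)
    (q : EuclideanSpace ℝ (Fin d)) : -z ≤ ‖q‖ ^ 2 / (2 * T) - z := by
  have : 0 ≤ ‖q‖ ^ 2 / (2 * T) := by positivity
  linarith

/-- A polynomially bounded function times an exponentially decaying function of
`‖q‖² / (2T) - z` is integrable. -/
lemma integrable_mul_radial {d : ℕ} (hd : 1 ≤ d) {T : ℝ} (hT : 0 < T) {z : ℝ}
    {p : EuclideanSpace ℝ (Fin d) → ℝ} (hp : Continuous p) {m : ℕ} {B : ℝ}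
    (hB : ∀ q, |p q| ≤ B * ‖q‖ ^ m) {f : ℝ → ℝ} (hf : ContinuousOn f (Ici (-z))) {C : ℝ}
    (hC : ∀ x, -z ≤ x → |f x| ≤ C * Real.exp (-x)) :
    Integrable fun q => p q * f (‖q‖ ^ 2 / (2 * T) - z) := by
  have : Nonempty (Fin d) := ⟨⟨0, hd⟩⟩
  have hint : Integrable fun q : EuclideanSpace ℝ (Fin d) =>
      ‖q‖ ^ m * Real.exp (-(‖q‖ ^ 2 / (2 * T))) := by
    rw [integrable_fun_norm_addHaar volume
      (f := fun r : ℝ => r ^ m * Real.exp (-(r ^ 2 / (2 * T))))]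
    refine (integrableOn_rpow_mul_exp_neg_mul_sq (b := (2 * T)⁻¹) (by positivity)
      (s := ((d - 1 + m : ℕ) : ℝ)) ?_).congr_fun ?_ measurableSet_Ioi
    · have : (0 : ℝ) ≤ ((d - 1 + m : ℕ) : ℝ) := Nat.cast_nonneg _
      linarith
    · intro r _
      simp only [Real.rpow_natCast, finrank_euclideanSpace, Fintype.card_fin, smul_eq_mul, pow_add]
      rw [mul_assoc]
      congr 3
      ring
  refine (hint.const_mul (B * C * Real.exp z)).mono' (hp.mul (hf.comp_continuous (by fun_prop)
    (neg_le_norm_sq_div_sub hT z))).aestronglyMeasurable (Eventually.of_forall fun q => ?_)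
  rw [norm_mul]
  calc ‖p q‖ * ‖f (‖q‖ ^ 2 / (2 * T) - z)‖
      ≤ (B * ‖q‖ ^ m) * (C * Real.exp (-(‖q‖ ^ 2 / (2 * T) - z))) :=
        mul_le_mul (hB q) (hC _ (neg_le_norm_sq_div_sub hT z q)) (abs_nonneg _)
          ((abs_nonneg _).trans (hB q))
    _ = _ := by
        have : Real.exp (-(‖q‖ ^ 2 / (2 * T) - z)) =
            Real.exp z * Real.exp (-(‖q‖ ^ 2 / (2 * T))) := by
          rw [← Real.exp_add]; congr 1; ring
        rw [this]; ring

lemma abs_coord_le_norm {d : ℕ} (q : EuclideanSpace ℝ (Fin d)) (i : Fin d) : |q i| ≤ ‖q‖ :=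
  PiLp.norm_apply_le q i

lemma hasLineDerivAt_coord {d : ℕ} (q : EuclideanSpace ℝ (Fin d)) (i j : Fin d) :
    HasLineDerivAt ℝ (fun x : EuclideanSpace ℝ (Fin d) => x j) (kron i j) q
      (EuclideanSpace.single i 1) := by
  have h : HasDerivAt (fun t : ℝ => q j + t * kron i j) (kron i j) 0 := by
    simpa using ((hasDerivAt_id (0 : ℝ)).mul_const (kron i j)).const_add (q j)
  refine h.congr_of_eventuallyEq (Eventually.of_forall fun t => ?_)
  simp [kron, eq_comm]

lemma hasLineDerivAt_norm_sq {d : ℕ} (q : EuclideanSpace ℝ (Fin d)) (i : Fin d) :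
    HasLineDerivAt ℝ (fun x : EuclideanSpace ℝ (Fin d) => ‖x‖ ^ 2) (2 * q i) q
      (EuclideanSpace.single i 1) := by
  have h := ((hasStrictFDerivAt_norm_sq q).hasFDerivAt).hasLineDerivAt (EuclideanSpace.single i 1)
  simpa [EuclideanSpace.inner_single_right] using h

/-- Integration by parts in the direction `e_i` for a radial profile `g (‖q‖²/(2T) - z)`. -/
lemma integral_mul_coord_mul_radial_deriv {d : ℕ} (hd : 1 ≤ d) {T : ℝ} (hT : 0 < T) {z : ℝ}
    {g g' : ℝ → ℝ} (hg : ∀ x, -z ≤ x → HasDerivAt g (g' x) x) (hg'c : ContinuousOn g' (Ici (-z)))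
    {C C' : ℝ} (hC : ∀ x, -z ≤ x → |g x| ≤ C * Real.exp (-x))
    (hC' : ∀ x, -z ≤ x → |g' x| ≤ C' * Real.exp (-x))
    (i : Fin d) {p p' : EuclideanSpace ℝ (Fin d) → ℝ} (hp : Continuous p) (hp'c : Continuous p')
    (hp' : ∀ q, HasLineDerivAt ℝ p (p' q) q (EuclideanSpace.single i 1))
    {m m' : ℕ} {B B' : ℝ} (hB : ∀ q, |p q| ≤ B * ‖q‖ ^ m) (hB' : ∀ q, |p' q| ≤ B' * ‖q‖ ^ m') :
    ∫ q, (p q * q i) * g' (‖q‖ ^ 2 / (2 * T) - z) =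
      -T * ∫ q, p' q * g (‖q‖ ^ 2 / (2 * T) - z) := by
  have hgc : ContinuousOn g (Ici (-z)) := fun x hx => (hg x hx).continuousAt.continuousWithinAt
  have hpi : ∀ q : EuclideanSpace ℝ (Fin d), |p q * q i| ≤ B * ‖q‖ ^ (m + 1) := fun q => by
    rw [abs_mul, pow_succ, ← mul_assoc]
    exact mul_le_mul (hB q) (abs_coord_le_norm q i) (abs_nonneg _) ((abs_nonneg _).trans (hB q))
  have hI := integrable_mul_radial hd hT (p := fun q => p q * q i) (by fun_prop) hpi hg'c hC'
  have hderiv : ∀ q : EuclideanSpace ℝ (Fin d), HasLineDerivAt ℝ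
      (fun x : EuclideanSpace ℝ (Fin d) => g (‖x‖ ^ 2 / (2 * T) - z))
      (q i * g' (‖q‖ ^ 2 / (2 * T) - z) / T) q (EuclideanSpace.single i 1) := fun q => by
    have h1 : HasDerivAt (fun t : ℝ => ‖q + t • EuclideanSpace.single i (1 : ℝ)‖ ^ 2 / (2 * T) - z)
        (2 * q i / (2 * T)) 0 :=
      (HasDerivAt.div_const (hasLineDerivAt_norm_sq q i) (2 * T)).sub_const z
    have h2 : HasDerivAt g (g' (‖q‖ ^ 2 / (2 * T) - z))
        (‖q + (0 : ℝ) • EuclideanSpace.single i (1 : ℝ)‖ ^ 2 / (2 * T) - z) := by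
      simpa using hg _ (neg_le_norm_sq_div_sub hT z q)
    refine HasDerivAt.congr_deriv (h2.comp (0 : ℝ) h1) ?_
    field_simp
  have hIBP := integral_bilinear_hasLineDerivAt_right_eq_neg_left_of_integrable
    (μ := (volume : Measure (EuclideanSpace ℝ (Fin d)))) (B := ContinuousLinearMap.mul ℝ ℝ)
    (f := p) (f' := p') (g := fun x : EuclideanSpace ℝ (Fin d) => g (‖x‖ ^ 2 / (2 * T) - z))
    (g' := fun q => q i * g' (‖q‖ ^ 2 / (2 * T) - z) / T) (v := EuclideanSpace.single i 1)
    (integrable_mul_radial hd hT hp'c hB' hgc hC)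
    ((hI.div_const T).congr (Eventually.of_forall fun q => by
      simp only [ContinuousLinearMap.mul_apply']; ring))
    (integrable_mul_radial hd hT hp hB hgc hC)
    (fun q _ => hp' q) (fun q _ => hderiv q)
  simp only [ContinuousLinearMap.mul_apply'] at hIBP
  rw [neg_mul, ← mul_neg, ← hIBP, ← integral_const_mul]
  congr 1
  ext q
  field_simp

/-- With `h(q) = |q|²/(2T) - A/T` and `F_k = e^{kh}/(e^h + λ)^{k+1}`, one has
`∫_{ℝ^d} q_i q_j q_{k'} q_l ((1/3)F_1 - 2F_2 + 2F_3) dq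
  = (1/3)(δ_{ij}δ_{k'l} + δ_{ik'}δ_{jl} + δ_{il}δ_{jk'}) n_d T² φ_{d/2}'(A/T)`,
where `φ_{d/2} = I_1^{d/2}` is differentiable on `{z | λ e^z > -1}` and
`n_d = (2πT)^{d/2}`. -/
theorem fourth_moment_F_combination (d : ℕ) (hd : 1 ≤ d) (T : ℝ) (hT : 0 < T)
    (A lam : ℝ) (hz : lam * Real.exp (A / T) > -1)
    (h : EuclideanSpace ℝ (Fin d) → ℝ)
    (hh : ∀ q, h q = ‖q‖ ^ 2 / (2 * T) - A / T)
    (F : ℕ → EuclideanSpace ℝ (Fin d) → ℝ)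
    (hF : ∀ (k : ℕ) q, F k q = Real.exp (k * h q) / (Real.exp (h q) + lam) ^ (k + 1))
    (i j k' l : Fin d) :
    (∀ z : ℝ, lam * Real.exp z > -1 →
      DifferentiableAt ℝ (fermiI lam ((d : ℝ) / 2) 1) z) ∧
    (∫ q : EuclideanSpace ℝ (Fin d),
        q i * q j * q k' * q l * ((1 / 3) * F 1 q - 2 * F 2 q + 2 * F 3 q))
      = (1 / 3) * (kron i j * kron k' l + kron i k' * kron j l + kron i l * kron j k') *
        (2 * Real.pi * T) ^ ((d : ℝ) / 2) * T ^ 2 *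
        deriv (fermiI lam ((d : ℝ) / 2) 1) (A / T) := by
  have hs : (0 : ℝ) < (d : ℝ) / 2 := by
    have : (0 : ℝ) < d := by exact_mod_cast hd
    positivity
  refine ⟨fun z hz' => (hasDerivAt_fermiI_one hs hz').differentiableAt, ?_⟩
  set z := A / T with hz_def
  have hFp : ∀ k q, F k q = fermiProfile lam k (‖q‖ ^ 2 / (2 * T) - z) := fun k q => by
    rw [hF, hh, fermiProfile]
  let g₁ : ℝ → ℝ := fun x => fermiProfile lam 1 x - 2 * fermiProfile lam 2 x
  let g₂ : ℝ → ℝ := fun x =>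
    fermiProfile lam 1 x - 6 * fermiProfile lam 2 x + 6 * fermiProfile lam 3 x
  obtain ⟨C₁, hC₁⟩ := exists_abs_fermiProfile_le hz 1
  obtain ⟨C₂, hC₂⟩ := exists_abs_fermiProfile_le hz 2
  obtain ⟨C₃, hC₃⟩ := exists_abs_fermiProfile_le hz 3
  have hg₁ : ∀ x, -z ≤ x → |g₁ x| ≤ (C₁ + 2 * C₂) * Real.exp (-x) := fun x hx => by
    have h1 := abs_le.1 (hC₁ x hx)
    have h2 := abs_le.1 (hC₂ x hx)
    exact abs_le.2 ⟨by simp only [g₁]; linarith, by simp only [g₁]; linarith⟩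
  have hg₂ : ∀ x, -z ≤ x → |g₂ x| ≤ (C₁ + 6 * C₂ + 6 * C₃) * Real.exp (-x) := fun x hx => by
    have h1 := abs_le.1 (hC₁ x hx)
    have h2 := abs_le.1 (hC₂ x hx)
    have h3 := abs_le.1 (hC₃ x hx)
    exact abs_le.2 ⟨by simp only [g₂]; linarith, by simp only [g₂]; linarith⟩
  have hd₁ : ∀ x, -z ≤ x → HasDerivAt (fermiProfile lam 1) (g₁ x) x := fun x hx => by
    refine (hasDerivAt_fermiProfile (exp_add_pos_s15 hz hx) 1).congr_deriv ?_
    simp only [g₁]; norm_num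
  have hd₂ : ∀ x, -z ≤ x → HasDerivAt g₁ (g₂ x) x := fun x hx => by
    have hpos := exp_add_pos_s15 hz hx
    refine ((hasDerivAt_fermiProfile hpos 1).sub
      ((hasDerivAt_fermiProfile hpos 2).const_mul 2)).congr_deriv ?_
    simp only [g₂]; norm_num; ring
  have hc₁ : ContinuousOn g₁ (Ici (-z)) := fun x hx =>
    (hd₂ x hx).continuousAt.continuousWithinAt
  have hc₂ : ContinuousOn g₂ (Ici (-z)) :=
    ((continuousOn_fermiProfile hz 1).sub ((continuousOn_fermiProfile hz 2).const_smul (6 : ℝ))).add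
      ((continuousOn_fermiProfile hz 3).const_smul (6 : ℝ))
  have hkron : ∀ a b : Fin d, |kron a b| ≤ 1 := fun a b => by
    unfold kron; split_ifs <;> simp
  have second : ∀ a b : Fin d, ∫ q : EuclideanSpace ℝ (Fin d),
      (q a * q b) * g₁ (‖q‖ ^ 2 / (2 * T) - z) =
      -T * (kron a b * ∫ q : EuclideanSpace ℝ (Fin d),
        fermiProfile lam 1 (‖q‖ ^ 2 / (2 * T) - z)) := fun a b => by
    rw [← integral_const_mul, ← integral_mul_coord_mul_radial_deriv hd hT hd₁ hc₁ hC₁ hg₁ a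
      (p := fun q => q b) (p' := fun _ => kron a b) (m := 1) (m' := 0) (B := 1) (B' := 1)
      (by fun_prop) (by fun_prop) (fun q => hasLineDerivAt_coord q a b)
      (fun q => by simpa using abs_coord_le_norm q b) (fun q => by simpa using hkron a b)]
    congr 1; ext q; ring
  have hpair : ∀ (a b : Fin d) (q : EuclideanSpace ℝ (Fin d)), |q a * q b| ≤ 1 * ‖q‖ ^ 2 :=
    fun a b q => by
      rw [abs_mul, one_mul, sq]
      exact mul_le_mul (abs_coord_le_norm q a) (abs_coord_le_norm q b) (abs_nonneg _)
        (norm_nonneg _)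
  have hint : ∀ a b : Fin d, Integrable fun q : EuclideanSpace ℝ (Fin d) =>
      (q a * q b) * g₁ (‖q‖ ^ 2 / (2 * T) - z) := fun a b =>
    integrable_mul_radial hd hT (by fun_prop) (hpair a b) hc₁ hg₁
  have hkpair : ∀ (a b a' b' : Fin d) (q : EuclideanSpace ℝ (Fin d)),
      |kron a' b' * (q a * q b)| ≤ ‖q‖ ^ 2 := fun a b a' b' q => by
    rw [abs_mul]
    have := mul_le_mul (hkron a' b') (hpair a b q) (abs_nonneg _) one_pos.le
    linarith
  have fourth : ∫ q : EuclideanSpace ℝ (Fin d),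
      (q j * q k' * q l * q i) * g₂ (‖q‖ ^ 2 / (2 * T) - z) =
      -T * ∫ q : EuclideanSpace ℝ (Fin d),
        (kron i j * (q k' * q l) + kron i k' * (q j * q l) + kron i l * (q j * q k')) *
          g₁ (‖q‖ ^ 2 / (2 * T) - z) := by
    refine integral_mul_coord_mul_radial_deriv hd hT hd₂ hc₂ hg₁ hg₂ i
      (p := fun q => q j * q k' * q l) (m := 3) (m' := 2) (B := 1) (B' := 3)
      (by fun_prop) (by fun_prop) (fun q => ?_) (fun q => ?_) (fun q => ?_)
    · refine HasDerivAt.congr_deriv (HasDerivAt.mul (HasDerivAt.mul (hasLineDerivAt_coord q i j)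
        (hasLineDerivAt_coord q i k')) (hasLineDerivAt_coord q i l)) ?_
      simp
      ring
    · rw [abs_mul, pow_succ, ← mul_assoc]
      exact mul_le_mul (hpair j k' q) (abs_coord_le_norm q l) (abs_nonneg _) (by positivity)
    · have h1 := hkpair k' l i j q
      have h2 := hkpair j l i k' q
      have h3 := hkpair j k' i l q
      refine (abs_add_three _ _ _).trans ?_
      linarith
  have split : ∫ q : EuclideanSpace ℝ (Fin d),
        (kron i j * (q k' * q l) + kron i k' * (q j * q l) + kron i l * (q j * q k')) *
          g₁ (‖q‖ ^ 2 / (2 * T) - z) =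
      kron i j * (∫ q : EuclideanSpace ℝ (Fin d), (q k' * q l) * g₁ (‖q‖ ^ 2 / (2 * T) - z)) +
      kron i k' * (∫ q : EuclideanSpace ℝ (Fin d), (q j * q l) * g₁ (‖q‖ ^ 2 / (2 * T) - z)) +
      kron i l * (∫ q : EuclideanSpace ℝ (Fin d), (q j * q k') * g₁ (‖q‖ ^ 2 / (2 * T) - z)) := by
    have hsum : Integrable fun q : EuclideanSpace ℝ (Fin d) =>
        kron i j * ((q k' * q l) * g₁ (‖q‖ ^ 2 / (2 * T) - z)) +
        kron i k' * ((q j * q l) * g₁ (‖q‖ ^ 2 / (2 * T) - z)) :=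
      ((hint k' l).const_mul _).add ((hint j l).const_mul _)
    rw [← integral_const_mul, ← integral_const_mul, ← integral_const_mul,
      ← integral_add ((hint k' l).const_mul _) ((hint j l).const_mul _),
      ← integral_add hsum ((hint j k').const_mul _)]
    congr 1; ext q; ring
  have hradial := integral_euclideanSpace_norm_sq_div hd hT fun x => fermiProfile lam 1 (x - z)
  calc _ = ∫ q : EuclideanSpace ℝ (Fin d),
        1 / 3 * ((q j * q k' * q l * q i) * g₂ (‖q‖ ^ 2 / (2 * T) - z)) := by
        congr 1; ext q; simp only [hFp, g₂]; ring
    _ = _ := by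
        rw [integral_const_mul, fourth, split, second, second, second, hradial,
          (hasDerivAt_fermiI_one hs hz).deriv]
        ring
end

section
/- Let T* > 0, let θ : ℝ^d × [0, T*] → ℝ^d be continuously differentiable with all spatial derivatives ∂_j θ_k bounded on ℝ^d × [0, T*], and let R : ℝ^d × [0, T*] → ℝ^{d×d} be continuously differentiable, antisymmetric (R_{ik} = −R_{ki}), and such that R(·, t) is supported in a fixed compact subset of ℝ^d for all t. Suppose that for all indices i, k, ∂_t R_{ik} + Σ_j θ_j·∂_j R_{ik} + Σ_j R_{ij}·∂_k θ_j − Σ_j R_{kj}·∂_i θ_j = 0 on ℝ^d × [0, T*], and that R(·, 0) = 0. Then R ≡ 0 on ℝ^d × [0, T*]. -/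
open MeasureTheory Filter Set

/-- Spatial partial derivative `∂_j f` of `f : ℝ^d × ℝ → ℝ` (space × time). -/
noncomputable def pdx {d : ℕ} (f : EuclideanSpace ℝ (Fin d) × ℝ → ℝ) (j : Fin d)
    (p : EuclideanSpace ℝ (Fin d) × ℝ) : ℝ :=
  fderiv ℝ f p (EuclideanSpace.single j 1, 0)

/-- Time derivative `∂_t f` of `f : ℝ^d × ℝ → ℝ` (space × time). -/
noncomputable def pdt {d : ℕ} (f : EuclideanSpace ℝ (Fin d) × ℝ → ℝ)
    (p : EuclideanSpace ℝ (Fin d) × ℝ) : ℝ :=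
  fderiv ℝ f p (0, 1)

/-- The derivative of a function of space and time in the direction `(v, 1)`, in coordinates. -/
theorem fderiv_apply_prodMk_one {d : ℕ} (f : EuclideanSpace ℝ (Fin d) × ℝ → ℝ)
    (p : EuclideanSpace ℝ (Fin d) × ℝ) (v : EuclideanSpace ℝ (Fin d)) :
    fderiv ℝ f p (v, 1) = pdt f p + ∑ j, v j * pdx f j p := by
  have hv : ((v, 1) : EuclideanSpace ℝ (Fin d) × ℝ)
      = (0, 1) + ∑ j, v j • ((EuclideanSpace.single j 1, 0) : EuclideanSpace ℝ (Fin d) × ℝ) := by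
    ext i
    · simp [Prod.fst_sum, Pi.single_apply]
    · simp [Prod.snd_sum]
  simp only [hv, map_add, map_sum, map_smul, smul_eq_mul, pdt, pdx]

/-- Pointwise energy estimate for the zeroth-order part of the transport equation. -/
theorem sum_two_mul_mul_commutator_le {ι : Type*} [Fintype ι] {C : ℝ} (A B : ι → ι → ℝ)
    (hB : ∀ k j, |B k j| ≤ C) :
    ∑ i, ∑ k, 2 * A i k * ((∑ j, A k j * B i j) - ∑ j, A i j * B k j)
      ≤ 4 * Fintype.card ι * C * ∑ i, ∑ k, A i k ^ 2 := by
  have young (a b m : ℝ) (hm : |m| ≤ C) : 2 * a * (b * m) ≤ C * (a ^ 2 + b ^ 2) := by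
    obtain ⟨h₁, h₂⟩ := abs_le.mp hm
    nlinarith [mul_nonneg (sub_nonneg.mpr h₂) (sq_nonneg (a + b)),
      mul_nonneg (neg_le_iff_add_nonneg.mp h₁) (sq_nonneg (a - b))]
  calc ∑ i, ∑ k, 2 * A i k * ((∑ j, A k j * B i j) - ∑ j, A i j * B k j)
      ≤ ∑ i, ∑ k, ∑ j, (C * (A i k ^ 2 + A k j ^ 2) + C * (A i k ^ 2 + A i j ^ 2)) := by
        refine Finset.sum_le_sum fun i _ => Finset.sum_le_sum fun k _ => ?_
        rw [← Finset.sum_sub_distrib, Finset.mul_sum]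
        refine Finset.sum_le_sum fun j _ => ?_
        have h₁ := young (A i k) (A k j) (B i j) (hB i j)
        have h₂ := young (A i k) (A i j) (-B k j) (by simpa using hB k j)
        linarith
    _ = 4 * Fintype.card ι * C * ∑ i, ∑ k, A i k ^ 2 := by
        simp only [Finset.sum_add_distrib, ← Finset.mul_sum, Finset.sum_const, Finset.card_univ,
          nsmul_eq_mul]
        ring

/-- At a point of positive time where `f` is maximal over `E × [0, T]`, the derivative of `f` in
any direction pointing forward in time is nonnegative. -/
theorem fderiv_forward_nonneg_of_isMaxOn {E : Type*} [NormedAddCommGroup E] [NormedSpace ℝ E]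
    {f : E × ℝ → ℝ} {T t : ℝ} {x : E} (ht : t ∈ Set.Ioc 0 T)
    (hf : DifferentiableAt ℝ f (x, t)) (hmax : IsMaxOn f (Set.univ ×ˢ Set.Icc 0 T) (x, t)) (v : E) :
    0 ≤ fderiv ℝ f (x, t) (v, 1) := by
  have hcone : -t • ((v, 1) : E × ℝ) ∈
      posTangentConeAt (Set.univ ×ˢ Set.Icc 0 T : Set (E × ℝ)) (x, t) := by
    apply mem_posTangentConeAt_of_segment_subset
    refine (convex_univ.prod (convex_Icc 0 T)).segment_subset ?_ ?_
    · exact ⟨trivial, ht.1.le, ht.2⟩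
    · exact ⟨trivial, by simpa using ht.1.le.trans ht.2⟩
  have h := hmax.localize.hasFDerivWithinAt_nonpos hf.hasFDerivAt.hasFDerivWithinAt hcone
  rw [map_smul, smul_eq_mul] at h
  nlinarith [ht.1]

/-- An antisymmetric, compactly (in space) supported `C¹` tensor field `R` transported by
a `C¹` velocity field `θ` with bounded spatial derivatives, satisfying
`∂_t R_{ik} + Σ_j θ_j ∂_j R_{ik} + Σ_j R_{ij} ∂_k θ_j - Σ_j R_{kj} ∂_i θ_j = 0`
on `ℝ^d × [0,T*]` and vanishing at `t = 0`, vanishes identically on `ℝ^d × [0,T*]`. -/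
theorem irrotationality_propagates {d : ℕ} (Tstar : ℝ) (hT : 0 < Tstar)
    (θ : EuclideanSpace ℝ (Fin d) × ℝ → EuclideanSpace ℝ (Fin d))
    (hθ : ContDiff ℝ 1 θ)
    (hbd : ∃ C : ℝ, ∀ (x : EuclideanSpace ℝ (Fin d)), ∀ t ∈ Set.Icc 0 Tstar,
      ∀ j k : Fin d, |pdx (fun q => θ q k) j (x, t)| ≤ C)
    (R : EuclideanSpace ℝ (Fin d) × ℝ → Fin d → Fin d → ℝ)
    (hR : ContDiff ℝ 1 R)
    (hanti : ∀ p i k, R p i k = - R p k i)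
    (hsupp : ∃ K : Set (EuclideanSpace ℝ (Fin d)), IsCompact K ∧
      ∀ t ∈ Set.Icc 0 Tstar, ∀ x ∉ K, R (x, t) = 0)
    (hpde : ∀ (i k : Fin d) (x : EuclideanSpace ℝ (Fin d)), ∀ t ∈ Set.Icc 0 Tstar,
      pdt (fun q => R q i k) (x, t)
        + (∑ j, θ (x, t) j * pdx (fun q => R q i k) j (x, t))
        + (∑ j, R (x, t) i j * pdx (fun q => θ q j) k (x, t))
        - (∑ j, R (x, t) k j * pdx (fun q => θ q j) i (x, t)) = 0)
    (hinit : ∀ x, R (x, 0) = 0) :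
    ∀ (x : EuclideanSpace ℝ (Fin d)), ∀ t ∈ Set.Icc 0 Tstar, R (x, t) = 0 := by
  obtain ⟨C, hC⟩ := hbd
  obtain ⟨K, hK, hK0⟩ := hsupp
  by_contra! hne
  obtain ⟨x₁, t₁, ht₁, hR₁⟩ := hne
  let lam : ℝ := 4 * d * C + 1
  let E : EuclideanSpace ℝ (Fin d) × ℝ → ℝ := fun p => ∑ i, ∑ k, R p i k ^ 2
  let f : EuclideanSpace ℝ (Fin d) × ℝ → ℝ := fun p => Real.exp (-lam * p.2) * E p
  have hRd (i k : Fin d) : Differentiable ℝ fun q => R q i k :=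
    differentiable_pi.mp (differentiable_pi.mp (hR.differentiable one_ne_zero) i) k
  have hEd (p) : HasFDerivAt E
      (∑ i, ∑ k, (2 * R p i k) • fderiv ℝ (fun q => R q i k) p) p := by
    refine HasFDerivAt.fun_sum fun i _ => HasFDerivAt.fun_sum fun k _ => ?_
    simpa using (hRd i k p).hasFDerivAt.pow 2
  have hfd (p) : HasFDerivAt f _ p :=
    ((hasFDerivAt_snd (𝕜 := ℝ) (p := p)).const_mul (-lam)).exp.mul (hEd p)
  have hE_nonneg (p) : 0 ≤ E p := by positivity
  have hE_zero {p} (h : R p = 0) : f p = 0 := by simp [f, E, h]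
  have hf_nonneg (p) : 0 ≤ f p := mul_nonneg (Real.exp_pos _).le (hE_nonneg p)
  have hf₁ : 0 < f (x₁, t₁) := by
    refine mul_pos (Real.exp_pos _) ((hE_nonneg _).lt_of_ne fun h => hR₁ ?_)
    ext i k
    have h' := (Finset.sum_eq_zero_iff_of_nonneg fun i _ => by positivity).mp h.symm i
      (Finset.mem_univ i)
    simpa using (Finset.sum_eq_zero_iff_of_nonneg fun k _ => by positivity).mp h' k
      (Finset.mem_univ k)
  have hx₁ : x₁ ∈ K := by_contra fun h => hR₁ (hK0 t₁ ht₁ x₁ h)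
  obtain ⟨⟨x₀, t₀⟩, ⟨-, ht₀⟩, hmaxK⟩ := (hK.prod isCompact_Icc).exists_isMaxOn
    (s := K ×ˢ Set.Icc 0 Tstar) ⟨(x₁, t₁), hx₁, ht₁⟩
    (f := f) (fun p _ => (hfd p).continuousAt.continuousWithinAt)
  have hf₀ : 0 < f (x₀, t₀) := hf₁.trans_le (hmaxK ⟨hx₁, ht₁⟩)
  have hmax : IsMaxOn f (Set.univ ×ˢ Set.Icc 0 Tstar) (x₀, t₀) := by
    rintro ⟨x, t⟩ ⟨-, ht⟩
    by_cases hx : x ∈ K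
    · exact hmaxK ⟨hx, ht⟩
    · exact (hE_zero (hK0 t ht x hx)).trans_le (hf_nonneg _)
  have ht₀_pos : 0 < t₀ := by
    refine ht₀.1.lt_of_ne fun h => hf₀.ne' (hE_zero ?_)
    rw [show t₀ = 0 from h.symm, hinit]
  have hderiv := fderiv_forward_nonneg_of_isMaxOn ⟨ht₀_pos, ht₀.2⟩
    (hfd _).differentiableAt hmax (θ (x₀, t₀))
  have htransport (i k : Fin d) :
      fderiv ℝ (fun q => R q i k) (x₀, t₀) (θ (x₀, t₀), 1)
        = (∑ j, R (x₀, t₀) k j * pdx (fun q => θ q j) i (x₀, t₀))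
          - ∑ j, R (x₀, t₀) i j * pdx (fun q => θ q j) k (x₀, t₀) := by
    rw [fderiv_apply_prodMk_one]
    linarith [hpde i k x₀ t₀ ht₀]
  have henergy := sum_two_mul_mul_commutator_le (R (x₀, t₀))
    (fun i j => pdx (fun q => θ q j) i (x₀, t₀)) (hC x₀ t₀ ht₀)
  have hE₀ : 0 < E (x₀, t₀) := pos_of_mul_pos_right hf₀ (Real.exp_pos _).le
  have hexp := Real.exp_pos (-lam * t₀)
  rw [(hfd (x₀, t₀)).fderiv] at hderiv
  simp only [add_apply, smul_apply, sum_apply,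
    ContinuousLinearMap.coe_snd', smul_eq_mul, htransport] at hderiv
  simp only [Fintype.card_fin] at henergy
  change _ ≤ 4 * d * C * E (x₀, t₀) at henergy
  nlinarith [mul_le_mul_of_nonneg_left henergy hexp.le, mul_pos hexp hE₀]
end
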